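/- For a permutation w in S_n with length ℓ(w) = ℓ, the Bruhat interval polytope Q_{e,w} is combinatorially equivalent to the product Q_{e,3412} × I^{ℓ−4} of the Bruhat interval polytope Q_{e,3412} ⊂ ℝ^4 (where 3412 is the permutation 1↦3, 2↦4, 3↦1, 4↦2 in S_4) and the cube I^{ℓ−4} = [0,1]^{ℓ−4} if and only if w contains the pattern 3412 exactly once and avoids the pattern 321. -/

import Mathlib

/-- `simpleT n i` is the adjacent transposition `sᵢ = (i, i+1)` (one-indexed values),
acting on `{1, …, n}` represented (zero-indexed) by `Fin n`.  It is the identity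
permutation when `i` is outside the valid range `1 ≤ i ≤ n - 1`. -/
def simpleT (n : ℕ) (i : ℕ) : Equiv.Perm (Fin n) :=
  if h : 1 ≤ i ∧ i < n then Equiv.swap ⟨i - 1, by omega⟩ ⟨i, h.2⟩ else 1

/-- The (Coxeter) length `ℓ(w)`: the minimal number of adjacent transpositions whose
product is `w`. -/
noncomputable def permLen (n : ℕ) (w : Equiv.Perm (Fin n)) : ℕ :=
  sInf {l : ℕ | ∃ word : List ℕ, word.length = l ∧ (word.map (simpleT n)).prod = w}

/-- `word` is a reduced decomposition of `w`: its product is `w` and its length is `ℓ(w)`. -/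
def IsReducedWord (n : ℕ) (word : List ℕ) (w : Equiv.Perm (Fin n)) : Prop :=
  (word.map (simpleT n)).prod = w ∧ word.length = permLen n w

/-- The support of `w`: the set of letters `i` such that `sᵢ` appears in some reduced
decomposition of `w`. -/
def permSupp (n : ℕ) (w : Equiv.Perm (Fin n)) : Set ℕ :=
  {i | ∃ word : List ℕ, IsReducedWord n word w ∧ i ∈ word}

/-- Bruhat order: `v ≤ w` iff some reduced decomposition of `v` is a subword of some
reduced decomposition of `w`. -/
def bruhatLE (n : ℕ) (v w : Equiv.Perm (Fin n)) : Prop :=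
  ∃ wordv wordw : List ℕ, IsReducedWord n wordv v ∧ IsReducedWord n wordw w ∧
    wordv.Sublist wordw

/-- Strict Bruhat order. -/
def bruhatLT (n : ℕ) (v w : Equiv.Perm (Fin n)) : Prop :=
  bruhatLE n v w ∧ v ≠ w

/-- An occurrence of the pattern `p ∈ S_k` in `w ∈ S_n`: a strictly increasing sequence
`j` of indices such that the entries of `w` along `j` are in the same relative order
as the entries of `p`. -/
def IsPatternOcc {n k : ℕ} (w : Equiv.Perm (Fin n)) (p : Equiv.Perm (Fin k))
    (j : Fin k → Fin n) : Prop :=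
  StrictMono j ∧ ∀ a b : Fin k, w (j a) < w (j b) ↔ p a < p b

/-- `w` contains the pattern `p`. -/
def ContainsPattern {n k : ℕ} (w : Equiv.Perm (Fin n)) (p : Equiv.Perm (Fin k)) : Prop :=
  ∃ j : Fin k → Fin n, IsPatternOcc w p j

/-- `w` avoids the pattern `p`. -/
def AvoidsPattern {n k : ℕ} (w : Equiv.Perm (Fin n)) (p : Equiv.Perm (Fin k)) : Prop :=
  ¬ ContainsPattern w p

/-- `w` contains the pattern `p` exactly once. -/
def ContainsPatternOnce {n k : ℕ} (w : Equiv.Perm (Fin n)) (p : Equiv.Perm (Fin k)) : Prop :=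
  ∃! j : Fin k → Fin n, IsPatternOcc w p j

/-- The number of occurrences of the pattern `p` in `w`. -/
noncomputable def numOcc {n k : ℕ} (w : Equiv.Perm (Fin n)) (p : Equiv.Perm (Fin k)) : ℕ :=
  Set.ncard {j : Fin k → Fin n | IsPatternOcc w p j}

/-- The pattern `321` (one-line notation `1↦3, 2↦2, 3↦1`), as a permutation of `Fin 3`. -/
def pattern321 : Equiv.Perm (Fin 3) := Equiv.swap 0 2

/-- The pattern `3412` (one-line notation `1↦3, 2↦4, 3↦1, 4↦2`). -/
def pattern3412 : Equiv.Perm (Fin 4) := Equiv.swap 0 2 * Equiv.swap 1 3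

/-- The pattern `4231` (one-line notation `1↦4, 2↦2, 3↦3, 4↦1`). -/
def pattern4231 : Equiv.Perm (Fin 4) := Equiv.swap 0 3

/-- The pattern `4321` (one-line notation `1↦4, 2↦3, 3↦2, 4↦1`). -/
def pattern4321 : Equiv.Perm (Fin 4) := Equiv.swap 0 3 * Equiv.swap 1 2

/-- The point `(u(1), …, u(n)) ∈ ℝⁿ` attached to a permutation `u` (one-indexed values). -/
def permPoint (n : ℕ) (u : Equiv.Perm (Fin n)) : Fin n → ℝ :=
  fun k => ((u k : ℕ) : ℝ) + 1

/-- The Bruhat interval polytope `Q_{v,w}`: the convex hull of the points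
`(u(1), …, u(n))` for all `u` with `v ≤ u ≤ w` in Bruhat order. -/
noncomputable def BIP (n : ℕ) (v w : Equiv.Perm (Fin n)) : Set (Fin n → ℝ) :=
  convexHull ℝ
    {x | ∃ u : Equiv.Perm (Fin n), bruhatLE n v u ∧ bruhatLE n u w ∧ x = permPoint n u}

/-- A face of a polytope `P`: a convex extreme subset of `P`. -/
def IsFaceOf {E : Type*} [AddCommGroup E] [Module ℝ E] (P F : Set E) : Prop :=
  IsExtreme ℝ P F ∧ Convex ℝ F

/-- Combinatorial equivalence of two polytopes: an inclusion-preserving (in both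
directions) bijection between their face lattices. -/
def CombEquiv {E F : Type*} [AddCommGroup E] [Module ℝ E] [AddCommGroup F] [Module ℝ F]
    (P : Set E) (Q : Set F) : Prop :=
  ∃ e : {A : Set E // IsFaceOf P A} ≃ {B : Set F // IsFaceOf Q B},
    ∀ A B : {A : Set E // IsFaceOf P A}, A.1 ⊆ B.1 ↔ (e A).1 ⊆ (e B).1

/-- The transposition `(i, j)` (one-indexed values, `1 ≤ i < j ≤ n`), acting on
`{1, …, n}` represented by `Fin n`; identity for invalid input. -/
def transpPerm (n i j : ℕ) : Equiv.Perm (Fin n) :=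
  if h : 1 ≤ i ∧ i < j ∧ j ≤ n then Equiv.swap ⟨i - 1, by omega⟩ ⟨j - 1, by omega⟩ else 1

/-- `T̄(u,[v,w])`: the set of transpositions `(i,j)`, `i < j`, with
`u < u·(i,j) ≤ w` and `ℓ(u·(i,j)) = ℓ(u) + 1`. -/
def upperT (n : ℕ) (u v w : Equiv.Perm (Fin n)) : Set (ℕ × ℕ) :=
  {p | 1 ≤ p.1 ∧ p.1 < p.2 ∧ p.2 ≤ n ∧
    bruhatLT n u (u * transpPerm n p.1 p.2) ∧ bruhatLE n (u * transpPerm n p.1 p.2) w ∧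
    permLen n (u * transpPerm n p.1 p.2) = permLen n u + 1}

/-- `T̲(u,[v,w])`: the set of transpositions `(i,j)`, `i < j`, with
`v ≤ u·(i,j) < u` and `ℓ(u·(i,j)) = ℓ(u) - 1`. -/
def lowerT (n : ℕ) (u v w : Equiv.Perm (Fin n)) : Set (ℕ × ℕ) :=
  {p | 1 ≤ p.1 ∧ p.1 < p.2 ∧ p.2 ≤ n ∧
    bruhatLE n v (u * transpPerm n p.1 p.2) ∧ bruhatLT n (u * transpPerm n p.1 p.2) u ∧
    permLen n (u * transpPerm n p.1 p.2) + 1 = permLen n u}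

/-- The permutohedron `Perm₂ ⊂ ℝ³`, a hexagon. -/
noncomputable def Perm2Hex : Set (Fin 3 → ℝ) :=
  convexHull ℝ {x | ∃ σ : Equiv.Perm (Fin 3), x = permPoint 3 σ}

/-- The action of `s_r` on one-indexed letters: swaps `r` and `r + 1`. -/
def srNat (r x : ℕ) : ℕ := if x = r then r + 1 else if x = r + 1 then r else x



def IsAff {E : Type*} [AddCommGroup E] [Module ℝ E] (f : E → ℝ) : Prop :=
  ∀ (y z : E) (t : ℝ), f (y + t • (z - y)) = f y + t * (f z - f y)

section conv
variable {E : Type*} [AddCommGroup E] [Module ℝ E]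

lemma combo_eq (y z : E) (a b : ℝ) (h : a + b = 1) : a • y + b • z = y + b • (z - y) := by
  have : a = 1 - b := by linarith
  subst this
  module

lemma IsAff.combo {f : E → ℝ} (hf : IsAff f) (y z : E) (a b : ℝ) (h : a + b = 1) :
    f (a • y + b • z) = a * f y + b * f z := by
  rw [combo_eq y z a b h, hf]
  have : a = 1 - b := by linarith
  subst this
  ring

lemma IsAff.convex_nonneg {f : E → ℝ} (hf : IsAff f) : Convex ℝ {y | 0 ≤ f y} := by
  intro y hy z hz a b ha hb hab
  simp only [Set.mem_setOf_eq] at *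
  rw [hf.combo y z a b hab]
  positivity

/-- every face of a hull is the hull of the generators it contains -/
lemma face_eq_hull {V F : Set E} (hF : IsFaceOf (convexHull ℝ V) F) :
    F = convexHull ℝ (V ∩ F) := by
  apply Set.Subset.antisymm
  · have key : convexHull ℝ V ⊆ {x | x ∈ convexHull ℝ V ∧ (x ∈ F → x ∈ convexHull ℝ (V ∩ F))} := by
      apply convexHull_min
      · intro v hv
        exact ⟨subset_convexHull ℝ V hv, fun h => subset_convexHull ℝ _ ⟨hv, h⟩⟩
      · rw [convex_iff_openSegment_subset]
        rintro x ⟨hx, hx'⟩ y ⟨hy, hy'⟩ z hz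
        refine ⟨(convex_iff_openSegment_subset.1 (convex_convexHull ℝ V)) hx hy hz, fun hzF => ?_⟩
        exact (convex_iff_openSegment_subset.1 (convex_convexHull ℝ _))
          (hx' (hF.1.left_mem_of_mem_openSegment hx hy hzF hz))
          (hy' (hF.1.right_mem_of_mem_openSegment hx hy hzF hz)) hz
    intro x hx
    exact (key (hF.1.subset hx)).2 hx
  · exact convexHull_min Set.inter_subset_right hF.2

lemma face_zero {P : Set E} (hP : Convex ℝ P) {J : Type*} (l : J → E → ℝ)
    (hl : ∀ j, IsAff (l j)) (h0 : ∀ j, ∀ y ∈ P, 0 ≤ l j y) :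
    IsFaceOf P {y | y ∈ P ∧ ∀ j, l j y = 0} := by
  refine ⟨⟨fun y hy => hy.1, ?_⟩, ?_⟩
  · rintro x hx y hy z ⟨hz, hz'⟩ ⟨a, b, ha, hb, hab, rfl⟩
    refine ⟨hx, fun j => ?_⟩
    have h1 := hz' j
    rw [(hl j).combo x y a b hab] at h1
    have hx0 := h0 j x hx
    have hy0 := h0 j y hy
    have h2 : a * l j x = 0 := by nlinarith [mul_nonneg ha.le hx0, mul_nonneg hb.le hy0]
    rcases mul_eq_zero.1 h2 with h | h
    · linarith
    · exact h
  · rintro x ⟨hx, hx'⟩ y ⟨hy, hy'⟩ a b ha hb hab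
    refine ⟨hP hx hy ha hb hab, fun j => ?_⟩
    rw [(hl j).combo x y a b hab, hx' j, hy' j]
    ring

end conv

/-- `V` is a finite point configuration with complete inequality description
whose incidence relation is `I`. -/
def Realizes {E : Type*} [AddCommGroup E] [Module ℝ E] {ι J : Type}
    (I : ι → J → Prop) (V : Set E) : Prop :=
  ∃ (x : ι → E) (L : Set E) (l : J → E → ℝ),
    Set.range x = V ∧
    (∀ y ∈ L, ∀ z ∈ L, ∀ t : ℝ, y + t • (z - y) ∈ L) ∧
    (∀ i, x i ∈ L) ∧
    (∀ j, IsAff (l j)) ∧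
    (∀ i j, 0 ≤ l j (x i)) ∧
    (∀ i j, I i j ↔ l j (x i) = 0) ∧
    (∀ y ∈ L, (∀ j, 0 ≤ l j y) → y ∈ convexHull ℝ V)

def GoodSet {ι J : Type} (I : ι → J → Prop) (S : Set ι) : Prop :=
  S = ∅ ∨ ∀ i, (∀ j, (∀ i' ∈ S, I i' j) → I i j) → i ∈ S

section realize
variable {E : Type*} [AddCommGroup E] [Module ℝ E]

lemma realizes_faces {ι J : Type} [Finite J] {I : ι → J → Prop} {V : Set E}
    (h : Realizes I V) :
    ∃ e : {A : Set E // IsFaceOf (convexHull ℝ V) A} ≃ {S : Set ι // GoodSet I S},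
      ∀ A B, A.1 ⊆ B.1 ↔ (e A).1 ⊆ (e B).1 := by
  obtain ⟨x, L, l, hxV, hL, hxL, hl, hpos, hI, hcomp⟩ := h
  have hxP : ∀ i, x i ∈ convexHull ℝ V := fun i => subset_convexHull ℝ V (hxV ▸ ⟨i, rfl⟩)
  have hPpos : ∀ j, ∀ y ∈ convexHull ℝ V, 0 ≤ l j y := by
    intro j
    apply convexHull_min (t := {y | 0 ≤ l j y}) _ (hl j).convex_nonneg
    rw [← hxV]
    rintro _ ⟨i, rfl⟩
    exact hpos i j
  have hPL : convexHull ℝ V ⊆ L := by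
    apply convexHull_min
    · rw [← hxV]; rintro _ ⟨i, rfl⟩; exact hxL i
    · intro y hy z hz a b ha hb hab
      rw [combo_eq y z a b hab]
      exact hL y hy z hz b
  have hFS : ∀ F, IsFaceOf (convexHull ℝ V) F → F = convexHull ℝ (x '' {i | x i ∈ F}) := by
    intro F hF
    have h1 := face_eq_hull hF
    have h2 : V ∩ F = x '' {i | x i ∈ F} := by
      rw [← hxV]
      ext y
      constructor
      · rintro ⟨⟨i, rfl⟩, hy⟩
        exact ⟨i, hy, rfl⟩
      · rintro ⟨i, hi, rfl⟩
        exact ⟨⟨i, rfl⟩, hi⟩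
    rw [h2] at h1
    exact h1
  have hgood : ∀ F, IsFaceOf (convexHull ℝ V) F → GoodSet I {i | x i ∈ F} := by
    intro F hF
    rcases Set.eq_empty_or_nonempty {i | x i ∈ F} with he | ⟨i0, hi0⟩
    · exact Or.inl he
    right
    intro i hi
    have hex : ∀ T : Finset J, ∃ y ∈ F, ∀ j ∈ T, (∃ i' , x i' ∈ F ∧ ¬ I i' j) → 0 < l j y := by
      classical
      intro T
      induction T using Finset.induction_on with
      | empty => exact ⟨x i0, hi0, by simp⟩
      | insert j T hj ih =>
        obtain ⟨y, hy, hyT⟩ := ih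
        by_cases hc : ∃ i' , x i' ∈ F ∧ ¬ I i' j
        · obtain ⟨i', hi', hIi⟩ := hc
          refine ⟨(1/2 : ℝ) • y + (1/2 : ℝ) • x i',
            hF.2 hy hi' (by norm_num) (by norm_num) (by norm_num), ?_⟩
          intro k hk hk'
          rw [(hl k).combo _ _ _ _ (by norm_num)]
          have e1 := hPpos k y (hF.1.subset hy)
          have e2 := hpos i' k
          rcases Finset.mem_insert.1 hk with rfl | hk
          · have : l k (x i') ≠ 0 := fun h => hIi ((hI i' k).2 h)
            have := lt_of_le_of_ne e2 this.symm
            linarith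
          · have := hyT k hk hk'
            linarith
        · refine ⟨y, hy, ?_⟩
          intro k hk hk'
          rcases Finset.mem_insert.1 hk with rfl | hk
          · exact absurd hk' hc
          · exact hyT k hk hk'
    have := Fintype.ofFinite J
    obtain ⟨y, hyF, hy⟩ := hex Finset.univ
    have hyP := hF.1.subset hyF
    have hev : ∀ᶠ ε in nhdsWithin (0:ℝ) (Set.Ioi 0), ∀ j, 0 ≤ l j (y + (-ε) • (x i - y)) := by
      rw [Filter.eventually_all]
      intro j
      by_cases hc : ∃ i', x i' ∈ F ∧ ¬ I i' j
      · have hp := hy j (Finset.mem_univ _) hc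
        have hcont : Continuous (fun ε : ℝ => l j y + (-ε) * (l j (x i) - l j y)) := by fun_prop
        have h1 : ∀ᶠ ε in nhds (0:ℝ), 0 < l j y + (-ε) * (l j (x i) - l j y) :=
          hcont.continuousAt.eventually (lt_mem_nhds (by simpa using hp))
        refine (h1.filter_mono nhdsWithin_le_nhds).mono fun ε hε => ?_
        rw [hl j]
        exact hε.le
      · push Not at hc
        have h1 : I i j := hi j hc
        have h2 := (hI i j).1 h1
        refine Filter.Eventually.filter_mono le_rfl ?_
        filter_upwards [self_mem_nhdsWithin] with ε hε
        rw [hl j, h2]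
        have := hPpos j y hyP
        have : (0:ℝ) < ε := hε
        nlinarith
    obtain ⟨ε, hε, hε0⟩ := (hev.and self_mem_nhdsWithin).exists
    have hε0 : (0:ℝ) < ε := hε0
    have hz : y + (-ε) • (x i - y) ∈ convexHull ℝ V :=
      hcomp _ (hL y (hPL hyP) _ (hxL i) _) hε
    refine hF.1.left_mem_of_mem_openSegment (hxP i) hz hyF ?_
    refine ⟨ε / (1 + ε), 1 / (1 + ε), by positivity, by positivity, by field_simp; ring, ?_⟩
    have h1 : (1 + ε) ≠ 0 := by positivity
    have h2 : ε / (1 + ε) = (1 / (1+ε)) * ε := by ring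
    rw [h2, mul_smul, ← smul_add]
    have h3 : ε • x i + (y + -ε • (x i - y)) = (1 + ε) • y := by module
    rw [h3, smul_smul]
    have h4 : 1 / (1 + ε) * (1 + ε) = 1 := by field_simp
    rw [h4, one_smul]
  have hface : ∀ S, GoodSet I S → IsFaceOf (convexHull ℝ V) (convexHull ℝ (x '' S)) ∧
      {i | x i ∈ convexHull ℝ (x '' S)} = S := by
    intro S hS
    rcases hS with rfl | hS
    · constructor
      · simp only [Set.image_empty, convexHull_empty]
        exact ⟨⟨Set.empty_subset _, fun x _ y _ z hz => absurd hz (Set.notMem_empty z)⟩, convex_empty⟩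
      · simp
    · have hf := face_zero (convex_convexHull ℝ V)
        (fun j : {j // ∀ i ∈ S, I i j} => l j.1) (fun j => hl j.1) (fun j => hPpos j.1)
      have e1 := hFS _ hf
      have e2 : {i | x i ∈ {y | y ∈ convexHull ℝ V ∧ ∀ j : {j // ∀ i ∈ S, I i j}, l j.1 y = 0}} = S := by
        ext i
        simp only [Set.mem_setOf_eq]
        constructor
        · rintro ⟨_, h⟩
          exact hS i fun j hj => (hI i j).2 (h ⟨j, hj⟩)
        · intro h
          exact ⟨hxP i, fun j => (hI i j.1).1 (j.2 i h)⟩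
      rw [e2] at e1
      rw [← e1]
      exact ⟨hf, e2⟩
  refine ⟨⟨fun A => ⟨{i | x i ∈ A.1}, hgood _ A.2⟩,
    fun S => ⟨convexHull ℝ (x '' S.1), (hface _ S.2).1⟩, ?_, ?_⟩, ?_⟩
  · intro A
    exact Subtype.ext (hFS _ A.2).symm
  · intro S
    exact Subtype.ext (hface _ S.2).2
  · intro A B
    constructor
    · intro h i hi
      exact h hi
    · intro h
      rw [hFS _ A.2, hFS _ B.2]
      exact convexHull_mono (Set.image_mono h)

lemma realizes_combEquiv {F : Type*} [AddCommGroup F] [Module ℝ F]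
    {ι J : Type} [Finite J] {I : ι → J → Prop} {V : Set E} {V' : Set F}
    (h : Realizes I V) (h' : Realizes I V') :
    CombEquiv (convexHull ℝ V) (convexHull ℝ V') := by
  obtain ⟨e, he⟩ := realizes_faces h
  obtain ⟨e', he'⟩ := realizes_faces h'
  refine ⟨e.trans e'.symm, fun A B => ?_⟩
  rw [he A B, he' ((e.trans e'.symm) A) ((e.trans e'.symm) B)]
  simp

lemma Realizes.reindex {ι J ι' J' : Type} {I : ι → J → Prop} {V : Set E}
    (h : Realizes I V) (I' : ι' → J' → Prop) (e : ι' → ι) (he : Function.Surjective e)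
    (f : J' → J) (hf : Function.Surjective f) (hII : ∀ i j, I' i j ↔ I (e i) (f j)) :
    Realizes I' V := by
  obtain ⟨x, L, l, hxV, hL, hxL, hl, hpos, hI, hcomp⟩ := h
  refine ⟨x ∘ e, L, l ∘ f, ?_, hL, fun i => hxL _, fun j => hl _, fun i j => hpos _ _,
    fun i j => ?_, fun y hy hj => hcomp y hy fun j => ?_⟩
  · rw [he.range_comp, hxV]
  · rw [hII]; exact hI _ _
  · obtain ⟨j, rfl⟩ := hf j
    exact hj j

def prodI {ι J ι' J' : Type} (I : ι → J → Prop) (I' : ι' → J' → Prop) :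
    ι × ι' → J ⊕ J' → Prop
  | i, Sum.inl j => I i.1 j
  | i, Sum.inr j => I' i.2 j

lemma Realizes.prod {F : Type*} [AddCommGroup F] [Module ℝ F] {ι J ι' J' : Type}
    {I : ι → J → Prop} {V : Set E} (h : Realizes I V)
    {I' : ι' → J' → Prop} {V' : Set F} (h' : Realizes I' V') :
    Realizes (prodI I I') (V ×ˢ V') := by
  obtain ⟨x, L, l, hxV, hL, hxL, hl, hpos, hI, hcomp⟩ := h
  obtain ⟨x', L', l', hxV', hL', hxL', hl', hpos', hI', hcomp'⟩ := h'
  refine ⟨fun i => (x i.1, x' i.2), L ×ˢ L', fun j y => Sum.elim (fun j => l j y.1)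
    (fun j => l' j y.2) j, ?_, ?_, ?_, ?_, ?_, ?_, ?_⟩
  · rw [← hxV, ← hxV']
    ext ⟨a, b⟩
    simp [Prod.ext_iff]
  · rintro y ⟨hy1, hy2⟩ z ⟨hz1, hz2⟩ t
    exact ⟨hL _ hy1 _ hz1 t, hL' _ hy2 _ hz2 t⟩
  · intro i
    exact ⟨hxL _, hxL' _⟩
  · rintro (j | j) y z t
    · exact hl j _ _ _
    · exact hl' j _ _ _
  · rintro i (j | j)
    · exact hpos _ _
    · exact hpos' _ _
  · rintro i (j | j)
    · exact hI _ _
    · exact hI' _ _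
  · rintro y ⟨hy1, hy2⟩ hj
    rw [convexHull_prod]
    exact ⟨hcomp _ hy1 fun j => hj (Sum.inl j), hcomp' _ hy2 fun j => hj (Sum.inr j)⟩

/-- twisted product -/
lemma Realizes.twist {F : Type*} [AddCommGroup F] [Module ℝ F] {ι J K JK : Type}
    {I : ι → J → Prop} {V : Set E} (h : Realizes I V)
    (IK : K → JK → Prop) (φ : K → E →ₗ[ℝ] F) (π : F → E) (M : Set F) (g : JK → F → ℝ)
    (hπ : ∀ y z (t : ℝ), π (y + t • (z - y)) = π y + t • (π z - π y))
    (hM : ∀ y ∈ M, ∀ z ∈ M, ∀ t : ℝ, y + t • (z - y) ∈ M)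
    (hg : ∀ j, IsAff (g j))
    (hπφ : ∀ k, ∀ x ∈ V, π (φ k x) = x)
    (hφM : ∀ k, ∀ x ∈ V, φ k x ∈ M)
    (hgpos : ∀ k j, ∀ x ∈ V, 0 ≤ g j (φ k x))
    (hgI : ∀ k j, ∀ x ∈ V, (IK k j ↔ g j (φ k x) = 0))
    (hcompK : ∀ y ∈ M, π y ∈ convexHull ℝ V → (∀ j, 0 ≤ g j y) →
      y ∈ convexHull ℝ (Set.range fun k => φ k (π y))) :
    Realizes (prodI I IK) {y | ∃ x ∈ V, ∃ k, y = φ k x} := by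
  obtain ⟨x, L, l, hxV, hL, hxL, hl, hpos, hI, hcomp⟩ := h
  have hx : ∀ i, x i ∈ V := fun i => hxV ▸ ⟨i, rfl⟩
  refine ⟨fun i => φ i.2 (x i.1), {y | π y ∈ L ∧ y ∈ M},
    fun j y => Sum.elim (fun j => l j (π y)) (fun j => g j y) j, ?_, ?_, ?_, ?_, ?_, ?_, ?_⟩
  · ext y
    constructor
    · rintro ⟨i, rfl⟩
      exact ⟨x i.1, hx _, i.2, rfl⟩
    · rintro ⟨v, hv, k, rfl⟩
      rw [← hxV] at hv
      obtain ⟨i, rfl⟩ := hv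
      exact ⟨(i, k), rfl⟩
  · rintro y ⟨hy1, hy2⟩ z ⟨hz1, hz2⟩ t
    refine ⟨?_, hM _ hy2 _ hz2 t⟩
    rw [hπ]
    exact hL _ hy1 _ hz1 t
  · intro i
    refine ⟨?_, hφM _ _ (hx _)⟩
    rw [hπφ _ _ (hx _)]
    exact hxL _
  · rintro (j | j) y z t
    · simp only [Sum.elim_inl]
      rw [hπ, hl]
    · exact hg j _ _ _
  · rintro i (j | j)
    · simp only [Sum.elim_inl]
      rw [hπφ _ _ (hx _)]
      exact hpos _ _
    · exact hgpos _ _ _ (hx _)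
  · rintro i (j | j)
    · simp only [Sum.elim_inl]
      rw [hπφ _ _ (hx _)]
      exact hI _ _
    · exact hgI _ _ _ (hx _)
  · rintro y ⟨hy1, hy2⟩ hj
    have h1 : π y ∈ convexHull ℝ V := hcomp _ hy1 fun j => hj (Sum.inl j)
    have h2 := hcompK y hy2 h1 fun j => hj (Sum.inr j)
    refine convexHull_min ?_ (convex_convexHull ℝ _) h2
    rintro _ ⟨k, rfl⟩
    have h3 : φ k (π y) ∈ (φ k) '' convexHull ℝ V := ⟨_, h1, rfl⟩
    rw [LinearMap.image_convexHull] at h3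
    refine convexHull_mono ?_ h3
    rintro _ ⟨v, hv, rfl⟩
    exact ⟨v, hv, k, rfl⟩

end realize

def cubeI (m : ℕ) : (Fin m → Bool) → Fin m × Bool → Prop := fun s j => s j.1 = j.2

def cubeV (m : ℕ) : Set (Fin m → ℝ) := Set.univ.pi fun _ => {0, 1}

lemma hull_cubeV (m : ℕ) :
    convexHull ℝ (cubeV m) = {x : Fin m → ℝ | ∀ k, x k ∈ Set.Icc (0 : ℝ) 1} := by
  unfold cubeV
  rw [convexHull_pi]
  ext x
  simp [convexHull_pair, segment_eq_Icc, Pi.le_def, forall_and]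

lemma realizes_cube (m : ℕ) : Realizes (cubeI m) (cubeV m) := by
  refine ⟨fun s k => if s k then 1 else 0, Set.univ, fun j y => if j.2 then 1 - y j.1 else y j.1,
    ?_, ?_, ?_, ?_, ?_, ?_, ?_⟩
  · ext y
    simp only [Set.mem_range, cubeV, Set.mem_pi, Set.mem_univ, true_imp_iff]
    constructor
    · rintro ⟨s, rfl⟩ k
      by_cases h : s k <;> simp [h]
    · intro h
      refine ⟨fun k => decide (y k = 1), ?_⟩
      ext k
      rcases h k with h | h
      · simp [h]
      · simp at h; simp [h]
  · intros; trivial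
  · intros; trivial
  · rintro ⟨k, b⟩ y z t
    cases b <;> simp <;> ring
  · rintro s ⟨k, b⟩
    cases b <;> by_cases h : s k <;> simp [h]
  · rintro s ⟨k, b⟩
    cases b <;> by_cases h : s k <;> simp [h, cubeI]
  · intro y _ hy
    rw [hull_cubeV]
    intro k
    have h1 := hy (k, true)
    have h2 := hy (k, false)
    simp at h1 h2
    exact ⟨h2, h1⟩

/-! extreme points are a combinatorial invariant -/

lemma combEquiv_extremePoints {E F : Type*} [AddCommGroup E] [Module ℝ E] [AddCommGroup F]
    [Module ℝ F] {P : Set E} {Q : Set F} (h : CombEquiv P Q)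
    (hP : P = convexHull ℝ (P.extremePoints ℝ)) (hQ : Q = convexHull ℝ (Q.extremePoints ℝ)) :
    Nat.card (P.extremePoints ℝ) = Nat.card (Q.extremePoints ℝ) := by
  have hex : ∀ {E : Type _} [AddCommGroup E] [Module ℝ E] {P : Set E},
      IsFaceOf P (∅ : Set E) := fun {E} _ _ {P} =>
    ⟨⟨Set.empty_subset _, fun x _ y _ z hz => absurd hz (Set.notMem_empty z)⟩, convex_empty⟩
  have hexF : IsFaceOf Q (∅ : Set F) :=
    ⟨⟨Set.empty_subset _, fun x _ y _ z hz => absurd hz (Set.notMem_empty z)⟩, convex_empty⟩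
  have hne : ∀ {E : Type _} [AddCommGroup E] [Module ℝ E] {P : Set E}
      (_ : P = convexHull ℝ (P.extremePoints ℝ)) (A : Set E) (_ : IsFaceOf P A) (_ : A.Nonempty),
      ∃ v ∈ P.extremePoints ℝ, v ∈ A := by
    intro E _ _ P hP A hA hAn
    rw [hP] at hA
    have := face_eq_hull hA
    rw [this] at hAn
    obtain ⟨v, hv⟩ := (convexHull_nonempty_iff).1 hAn
    exact ⟨v, hv⟩
  have hneF : ∀ (A : Set F) (_ : IsFaceOf Q A) (_ : A.Nonempty),
      ∃ v ∈ Q.extremePoints ℝ, v ∈ A := by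
    intro A hA hAn
    rw [hQ] at hA
    have := face_eq_hull hA
    rw [this] at hAn
    obtain ⟨v, hv⟩ := (convexHull_nonempty_iff).1 hAn
    exact ⟨v, hv⟩
  obtain ⟨e, he⟩ := h
  have he' : ∀ A B, A.1 ⊆ B.1 ↔ (e.symm A).1 ⊆ (e.symm B).1 := by
    intro A B
    rw [he]; simp
  have hbot : (e ⟨∅, hex⟩).1 = ∅ := by
    have : (e ⟨∅, hex⟩).1 ⊆ (⟨∅, hexF⟩ : {B : Set F // IsFaceOf Q B}).1 := by
      rw [he']; simp
    exact Set.subset_empty_iff.1 this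
  have hsymmbot : (e.symm ⟨∅, hexF⟩).1 = ∅ := by
    have : (⟨∅, hexF⟩ : {B : Set F // IsFaceOf Q B}) = e ⟨∅, hex⟩ := Subtype.ext hbot.symm
    rw [this]; simp
  have hsing : ∀ v ∈ P.extremePoints ℝ, IsFaceOf P ({v} : Set E) :=
    fun v hv => ⟨isExtreme_singleton.2 hv, convex_singleton v⟩
  have hsingF : ∀ v ∈ Q.extremePoints ℝ, IsFaceOf Q ({v} : Set F) :=
    fun v hv => ⟨isExtreme_singleton.2 hv, convex_singleton v⟩
  have key : ∀ v (hv : v ∈ P.extremePoints ℝ), ∃ u, ∃ hu : u ∈ Q.extremePoints ℝ,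
      e ⟨{v}, hsing v hv⟩ = ⟨{u}, hsingF u hu⟩ := by
    intro v hv
    have hn : (e ⟨{v}, hsing v hv⟩).1.Nonempty := by
      by_contra hcon
      rw [Set.not_nonempty_iff_eq_empty] at hcon
      have : e ⟨{v}, hsing v hv⟩ = e ⟨∅, hex⟩ := Subtype.ext (hcon.trans hbot.symm)
      have := congrArg Subtype.val (e.injective this)
      exact Set.singleton_ne_empty v this
    obtain ⟨u, hu, hu'⟩ := hneF _ (e ⟨{v}, hsing v hv⟩).2 hn
    refine ⟨u, hu, ?_⟩
    have h1 : (e.symm ⟨{u}, hsingF u hu⟩).1 ⊆ {v} := by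
      have : (⟨{u}, hsingF u hu⟩ : {B : Set F // IsFaceOf Q B}).1 ⊆ (e ⟨{v}, hsing v hv⟩).1 := by
        simpa using hu'
      rw [he'] at this
      simpa using this
    have h2 : (e.symm ⟨{u}, hsingF u hu⟩).1 ≠ ∅ := by
      intro hc
      have : e.symm ⟨{u}, hsingF u hu⟩ = e.symm ⟨∅, hexF⟩ := Subtype.ext (hc.trans hsymmbot.symm)
      have := congrArg Subtype.val (e.symm.injective this)
      exact Set.singleton_ne_empty u this
    have h3 : (e.symm ⟨{u}, hsingF u hu⟩).1 = {v} := by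
      rcases Set.subset_singleton_iff_eq.1 h1 with h | h
      · exact absurd h h2
      · exact h
    have h4 : e.symm ⟨{u}, hsingF u hu⟩ = ⟨{v}, hsing v hv⟩ := Subtype.ext h3
    rw [← h4]; simp
  have key' : ∀ u (hu : u ∈ Q.extremePoints ℝ), ∃ v, ∃ hv : v ∈ P.extremePoints ℝ,
      e ⟨{v}, hsing v hv⟩ = ⟨{u}, hsingF u hu⟩ := by
    intro u hu
    have hn : (e.symm ⟨{u}, hsingF u hu⟩).1.Nonempty := by
      by_contra hcon
      rw [Set.not_nonempty_iff_eq_empty] at hcon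
      have : e.symm ⟨{u}, hsingF u hu⟩ = e.symm ⟨∅, hexF⟩ := Subtype.ext (hcon.trans hsymmbot.symm)
      have := congrArg Subtype.val (e.symm.injective this)
      exact Set.singleton_ne_empty u this
    obtain ⟨v, hv, hv'⟩ := hne hP _ (e.symm ⟨{u}, hsingF u hu⟩).2 hn
    obtain ⟨u', hu', he1⟩ := key v hv
    refine ⟨v, hv, ?_⟩
    have h1 : (e ⟨{v}, hsing v hv⟩).1 ⊆ {u} := by
      have : (⟨{v}, hsing v hv⟩ : {B : Set E // IsFaceOf P B}).1 ⊆ (e.symm ⟨{u}, hsingF u hu⟩).1 := by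
        simpa using hv'
      rw [he] at this
      simpa using this
    rw [he1] at h1 ⊢
    have : u' = u := by simpa using h1
    subst this
    rfl
  choose f hf hfe using key
  refine Nat.card_congr (Equiv.ofBijective (fun v : P.extremePoints ℝ => (⟨f v.1 v.2, hf v.1 v.2⟩ : Q.extremePoints ℝ)) ⟨?_, ?_⟩)
  · rintro ⟨v, hv⟩ ⟨v', hv'⟩ heq
    have h1 : f v hv = f v' hv' := congrArg Subtype.val heq
    have h2 : e ⟨{v}, hsing v hv⟩ = e ⟨{v'}, hsing v' hv'⟩ := by
      rw [hfe v hv, hfe v' hv']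
      exact Subtype.ext (by simp [h1])
    have h3 := congrArg Subtype.val (e.injective h2)
    exact Subtype.ext (by simpa using h3)
  · rintro ⟨u, hu⟩
    obtain ⟨v, hv, h1⟩ := key' u hu
    refine ⟨⟨v, hv⟩, ?_⟩
    rw [hfe v hv] at h1
    have := congrArg Subtype.val h1
    exact Subtype.ext (by simpa using this)


section bruhat
open Equiv

variable {n : ℕ}

lemma simpleT_swap (d0 d1 : Fin n) (h : d0.val + 1 = d1.val) :
    simpleT n d1.val = swap d0 d1 := by
  unfold simpleT
  rw [dif_pos ⟨by omega, d1.2⟩]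
  congr 1
  exact Fin.ext (by simp; omega)

lemma simpleT_cases (n k : ℕ) : (¬ (1 ≤ k ∧ k < n) ∧ simpleT n k = 1) ∨
    ∃ d0 d1 : Fin n, d0.val + 1 = d1.val ∧ k = d1.val ∧ simpleT n k = swap d0 d1 := by
  by_cases h : 1 ≤ k ∧ k < n
  · right
    refine ⟨⟨k-1, by omega⟩, ⟨k, h.2⟩, by simp; omega, rfl, ?_⟩
    rw [← simpleT_swap] ; simp; omega
  · left
    exact ⟨h, by unfold simpleT; rw [dif_neg h]⟩

def invSet (w : Perm (Fin n)) : Finset (Fin n × Fin n) :=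
  Finset.univ.filter fun p => p.1 < p.2 ∧ w p.2 < w p.1

lemma mem_invSet (w : Perm (Fin n)) (p : Fin n × Fin n) :
    p ∈ invSet w ↔ p.1 < p.2 ∧ w p.2 < w p.1 := by simp [invSet]

def invN (w : Perm (Fin n)) : ℕ := (invSet w).card

lemma swap_lt_iff (d0 d1 : Fin n) (h : d0.val + 1 = d1.val) (a b : Fin n)
    (hab : ¬ (a = d0 ∧ b = d1)) (hab' : ¬ (a = d1 ∧ b = d0)) :
    swap d0 d1 a < swap d0 d1 b ↔ a < b := by
  simp only [swap_apply_def]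
  simp only [Fin.ext_iff, Fin.lt_def] at *
  split_ifs <;> omega

lemma invN_asc (w : Perm (Fin n)) (d0 d1 : Fin n) (h : d0.val + 1 = d1.val)
    (hw : w d0 < w d1) : invN (w * swap d0 d1) = invN w + 1 := by
  have hlt : d0 < d1 := by rw [Fin.lt_def]; omega
  have hne : d0 ≠ d1 := hlt.ne
  let E : (Fin n × Fin n) ≃ (Fin n × Fin n) := Equiv.prodCongr (swap d0 d1) (swap d0 d1)
  have key : invSet (w * swap d0 d1) = insert (d0, d1) ((invSet w).map E.toEmbedding) := by
    ext ⟨a, b⟩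
    simp only [Finset.mem_insert, Finset.mem_map_equiv, mem_invSet, E, Equiv.prodCongr_symm, Equiv.prodCongr_apply, Prod.map,
      Equiv.symm_swap, Perm.mul_apply, Prod.mk.injEq]
    by_cases h1 : a = d0 ∧ b = d1
    · obtain ⟨rfl, rfl⟩ := h1
      simp [hlt, hw]
    · by_cases h2 : a = d1 ∧ b = d0
      · obtain ⟨rfl, rfl⟩ := h2
        simp [hne, hne.symm, hlt.le, hw.le]
      · rw [swap_lt_iff d0 d1 h a b h1 h2]
        simp [h1]
  unfold invN
  rw [key, Finset.card_insert_of_notMem, Finset.card_map]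
  simp only [Finset.mem_map_equiv, mem_invSet, E, Equiv.prodCongr_symm,
    Equiv.prodCongr_apply, Prod.map, Equiv.symm_swap]
  simp [hlt.le]

lemma invN_desc (w : Perm (Fin n)) (d0 d1 : Fin n) (h : d0.val + 1 = d1.val)
    (hw : w d1 < w d0) : invN (w * swap d0 d1) + 1 = invN w := by
  have := invN_asc (w * swap d0 d1) d0 d1 h (by simpa using hw)
  simpa [mul_assoc] using this.symm

lemma invN_one : invN (1 : Perm (Fin n)) = 0 := by
  unfold invN invSet
  rw [Finset.card_eq_zero, Finset.filter_eq_empty_iff]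
  rintro ⟨a, b⟩ _ ⟨h1, h2⟩
  simp at h1 h2
  exact absurd h1 (not_lt.2 h2.le)

lemma invN_mul_simple_le (w : Perm (Fin n)) (k : ℕ) : invN (w * simpleT n k) ≤ invN w + 1 := by
  rcases simpleT_cases n k with ⟨_, h⟩ | ⟨d0, d1, h, _, h'⟩
  · rw [h]; simp
  · rw [h']
    rcases lt_trichotomy (w d0) (w d1) with h1 | h1 | h1
    · rw [invN_asc w d0 d1 h h1]
    · have := w.injective h1
      rw [this] at h; omega
    · have := invN_desc w d0 d1 h h1
      omega

lemma exists_descent (w : Perm (Fin n)) (hw : w ≠ 1) :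
    ∃ d0 d1 : Fin n, d0.val + 1 = d1.val ∧ w d1 < w d0 := by
  by_contra hcon
  push Not at hcon
  apply hw
  have hmono : StrictMono w := by
    cases n with
    | zero => intro a; exact a.elim0
    | succ n =>
      rw [Fin.strictMono_iff_lt_succ]
      intro i
      refine lt_of_le_of_ne (hcon _ _ (by simp)) ?_
      intro h
      have := w.injective h
      simp [Fin.ext_iff] at this
  ext i
  have h1 := DFunLike.congr_fun (Subsingleton.elim (hmono.orderIsoOfSurjective w w.surjective)
    (OrderIso.refl (Fin n))) i
  simpa using congrArg Fin.val h1

abbrev wprod (n : ℕ) (l : List ℕ) : Perm (Fin n) := (l.map (simpleT n)).prod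

lemma wprod_append (l l' : List ℕ) : wprod n (l ++ l') = wprod n l * wprod n l' := by
  simp [wprod]

lemma wprod_snoc (l : List ℕ) (k : ℕ) : wprod n (l ++ [k]) = wprod n l * simpleT n k := by
  simp [wprod]

lemma invN_wprod_le (l : List ℕ) : invN (wprod n l) ≤ l.length := by
  induction l using List.reverseRecOn with
  | nil => simp [wprod, invN_one]
  | append_singleton l k ih =>
    rw [wprod_snoc]
    have := invN_mul_simple_le (wprod n l) k
    simp; omega

lemma exists_word : ∀ (N : ℕ) (w : Perm (Fin n)), invN w = N →
    ∃ l : List ℕ, l.length = N ∧ wprod n l = w := by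
  intro N
  induction N with
  | zero =>
    intro w hw
    refine ⟨[], rfl, ?_⟩
    by_contra hne
    obtain ⟨d0, d1, h, h'⟩ := exists_descent w (fun h => hne (by simp [wprod, h]))
    have := invN_desc w d0 d1 h h'
    omega
  | succ N ih =>
    intro w hw
    have hne : w ≠ 1 := by
      rintro rfl
      rw [invN_one] at hw; omega
    obtain ⟨d0, d1, h, h'⟩ := exists_descent w hne
    obtain ⟨l, hl, hlw⟩ := ih (w * swap d0 d1) (by have := invN_desc w d0 d1 h h'; omega)
    refine ⟨l ++ [d1.val], by simp [hl], ?_⟩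
    rw [wprod_snoc, hlw, simpleT_swap d0 d1 h, mul_assoc]
    simp

lemma permLen_eq (w : Perm (Fin n)) : permLen n w = invN w := by
  unfold permLen
  apply le_antisymm
  · obtain ⟨l, hl, hlw⟩ := exists_word _ w rfl
    exact Nat.sInf_le ⟨l, hl, hlw⟩
  · apply le_csInf
    · obtain ⟨l, hl, hlw⟩ := exists_word _ w rfl
      exact ⟨_, l, hl, hlw⟩
    · rintro _ ⟨l, rfl, rfl⟩
      exact invN_wprod_le l

def Red (n : ℕ) (l : List ℕ) : Prop := l.length = invN (wprod n l)

lemma isReducedWord_iff (l : List ℕ) (w : Perm (Fin n)) :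
    IsReducedWord n l w ↔ wprod n l = w ∧ Red n l := by
  unfold IsReducedWord Red
  rw [permLen_eq]
  constructor
  · rintro ⟨h1, h2⟩
    exact ⟨h1, by rw [h2]; exact congrArg invN h1.symm⟩
  · rintro ⟨h1, h2⟩
    exact ⟨h1, by rw [h2, h1]⟩

lemma exists_red (w : Perm (Fin n)) : ∃ l, Red n l ∧ wprod n l = w := by
  obtain ⟨l, hl, hlw⟩ := exists_word _ w rfl
  exact ⟨l, by rw [Red, hl, hlw], hlw⟩

lemma Red.snoc {l : List ℕ} {k : ℕ} (h : Red n (l ++ [k])) :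
    Red n l ∧ ∃ d0 d1 : Fin n, d0.val + 1 = d1.val ∧ k = d1.val ∧ simpleT n k = swap d0 d1 ∧
      wprod n l d0 < wprod n l d1 := by
  unfold Red at *
  rw [wprod_snoc] at h
  have h1 := invN_wprod_le (n := n) l
  have h2 := invN_mul_simple_le (wprod n l) k
  simp at h
  refine ⟨by omega, ?_⟩
  rcases simpleT_cases n k with ⟨_, h3⟩ | ⟨d0, d1, h3, h4, h5⟩
  · rw [h3] at h; simp at h; omega
  · refine ⟨d0, d1, h3, h4, h5, ?_⟩
    rcases lt_trichotomy (wprod n l d0) (wprod n l d1) with h6 | h6 | h6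
    · exact h6
    · have := (wprod n l).injective h6
      rw [this] at h3; omega
    · have := invN_desc _ d0 d1 h3 h6
      rw [h5] at h; omega

lemma Red.prefix {l l' : List ℕ} (h : Red n (l ++ l')) : Red n l := by
  induction l' using List.reverseRecOn with
  | nil => simpa using h
  | append_singleton l' k ih =>
    rw [← List.append_assoc] at h
    exact ih h.snoc.1

lemma Red.valid {l : List ℕ} (h : Red n l) : ∀ k ∈ l, 1 ≤ k ∧ k < n := by
  induction l using List.reverseRecOn with
  | nil => simp
  | append_singleton l k ih =>
    obtain ⟨h1, d0, d1, h2, h3, -⟩ := h.snoc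
    intro j hj
    rw [List.mem_append, List.mem_singleton] at hj
    rcases hj with hj | rfl
    · exact ih h1 j hj
    · have := d1.2; omega

lemma Red.snoc_asc {l : List ℕ} (h : Red n l) (d0 d1 : Fin n) (hd : d0.val + 1 = d1.val)
    (hlt : wprod n l d0 < wprod n l d1) : Red n (l ++ [d1.val]) := by
  unfold Red at *
  rw [wprod_snoc, simpleT_swap d0 d1 hd, invN_asc _ d0 d1 hd hlt]
  simp [h]

/-- strong exchange -/
lemma strong_exchange (l : List ℕ) (a b : Fin n) (hab : a < b)
    (h : wprod n l b < wprod n l a) :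
    ∃ l', l'.Sublist l ∧ l'.length + 1 = l.length ∧ wprod n l' = wprod n l * swap a b := by
  induction l using List.reverseRecOn generalizing a b with
  | nil => simp [wprod] at h; exact absurd hab (not_lt.2 h.le)
  | append_singleton l k ih =>
    rw [wprod_snoc] at h
    rcases simpleT_cases n k with ⟨_, h3⟩ | ⟨d0, d1, h3, h4, h5⟩
    · rw [h3, mul_one] at h
      obtain ⟨l', h6, h7, h8⟩ := ih a b hab h
      refine ⟨l' ++ [k], List.Sublist.append h6 (List.Sublist.refl _), by simp; omega, ?_⟩
      rw [wprod_snoc, wprod_snoc, h3, h8]; simp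
    · rw [h5] at h
      by_cases h1 : a = d0 ∧ b = d1
      · obtain ⟨rfl, rfl⟩ := h1
        refine ⟨l, by simp, by simp, ?_⟩
        rw [wprod_snoc, h5, mul_assoc]; simp
      · have h2 : ¬ (a = d1 ∧ b = d0) := by
          rintro ⟨rfl, rfl⟩
          rw [Fin.lt_def] at hab; omega
        obtain ⟨l', h6, h7, h8⟩ := ih (swap d0 d1 a) (swap d0 d1 b)
          ((swap_lt_iff d0 d1 h3 a b h1 h2).2 hab) (by simpa using h)
        refine ⟨l' ++ [k], List.Sublist.append h6 (List.Sublist.refl _), by simp; omega, ?_⟩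
        rw [wprod_snoc, wprod_snoc, h5, h8, mul_assoc, mul_assoc]
        congr 1
        have := Equiv.mul_swap_eq_swap_mul (swap d0 d1) a b
        rw [this]

def Cov (x y : Perm (Fin n)) : Prop := ∃ a b, a < b ∧ x a < x b ∧ y = x * swap a b

def Ble (x y : Perm (Fin n)) : Prop := Relation.ReflTransGen Cov x y

def SubW (n : ℕ) (l : List ℕ) : Set (Perm (Fin n)) := {u | ∃ l', l'.Sublist l ∧ wprod n l' = u}

lemma subW_append (l1 l2 : List ℕ) (u : Perm (Fin n)) :
    u ∈ SubW n (l1 ++ l2) ↔ ∃ a ∈ SubW n l1, ∃ b ∈ SubW n l2, u = a * b := by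
  constructor
  · rintro ⟨l', h, rfl⟩
    obtain ⟨m1, m2, rfl, h1, h2⟩ := List.sublist_append_iff.1 h
    exact ⟨_, ⟨m1, h1, rfl⟩, _, ⟨m2, h2, rfl⟩, wprod_append _ _⟩
  · rintro ⟨_, ⟨m1, h1, rfl⟩, _, ⟨m2, h2, rfl⟩, rfl⟩
    exact ⟨m1 ++ m2, h1.append h2, wprod_append _ _⟩

lemma mem_subW_singleton (k : ℕ) (u : Perm (Fin n)) :
    u ∈ SubW n [k] ↔ u = 1 ∨ u = simpleT n k := by
  constructor
  · rintro ⟨l', h, rfl⟩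
    rcases List.sublist_singleton.1 h with h | h
    · left; simp [wprod, h]
    · right; simp [wprod, h]
  · rintro (rfl | rfl)
    · exact ⟨[], by simp, by simp [wprod]⟩
    · exact ⟨[k], by simp, by simp [wprod]⟩

lemma mem_subW_snoc (l : List ℕ) (k : ℕ) (u : Perm (Fin n)) :
    u ∈ SubW n (l ++ [k]) ↔ u ∈ SubW n l ∨ ∃ a ∈ SubW n l, u = a * simpleT n k := by
  rw [subW_append]
  constructor
  · rintro ⟨a, ha, b, hb, rfl⟩
    rcases (mem_subW_singleton k b).1 hb with rfl | rfl
    · left; simpa using ha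
    · right; exact ⟨a, ha, rfl⟩
  · rintro (h | ⟨a, ha, rfl⟩)
    · exact ⟨u, h, 1, (mem_subW_singleton _ _).2 (Or.inl rfl), by simp⟩
    · exact ⟨a, ha, _, (mem_subW_singleton _ _).2 (Or.inr rfl), rfl⟩

lemma subW_down (l : List ℕ) {x y : Perm (Fin n)} (h : Ble x y) (hy : y ∈ SubW n l) :
    x ∈ SubW n l := by
  induction h using Relation.ReflTransGen.head_induction_on with
  | refl => exact hy
  | head h _ ih =>
    rename_i a c
    obtain ⟨p, q, hpq, hx, rfl⟩ := h
    obtain ⟨l', hl', hl''⟩ := ih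
    obtain ⟨m, hm, _, hm'⟩ := strong_exchange l' p q hpq (by rw [hl'']; simpa using hx)
    refine ⟨m, hm.trans hl', ?_⟩
    rw [hm', hl'', mul_assoc]; simp

lemma ble_mul (w x : Perm (Fin n)) (d0 d1 : Fin n) (hd : d0.val + 1 = d1.val)
    (hw : w d0 < w d1) (h : Ble x w) : Ble (x * swap d0 d1) (w * swap d0 d1) := by
  have hlt : d0 < d1 := by rw [Fin.lt_def]; omega
  induction h using Relation.ReflTransGen.head_induction_on with
  | refl => exact Relation.ReflTransGen.refl
  | head h h' ih =>
    rename_i a c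
    obtain ⟨p, q, hpq, hx, rfl⟩ := h
    by_cases h1 : p = d0 ∧ q = d1
    · obtain ⟨rfl, rfl⟩ := h1
      exact h'.trans (Relation.ReflTransGen.single ⟨p, q, hlt, hw, rfl⟩)
    · have h2 : ¬ (p = d1 ∧ q = d0) := by
        rintro ⟨rfl, rfl⟩
        rw [Fin.lt_def] at hpq; omega
      refine Relation.ReflTransGen.head ⟨swap d0 d1 p, swap d0 d1 q,
        (swap_lt_iff d0 d1 hd p q h1 h2).2 hpq, by simpa using hx, ?_⟩ ih
      rw [mul_assoc, mul_assoc, Equiv.mul_swap_eq_swap_mul (swap d0 d1)]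
      simp

lemma subW_eq (l : List ℕ) (hl : Red n l) (u : Perm (Fin n)) :
    u ∈ SubW n l ↔ Ble u (wprod n l) := by
  constructor
  · induction l using List.reverseRecOn generalizing u with
    | nil =>
      rintro ⟨l', h, rfl⟩
      rw [List.sublist_nil] at h
      subst h
      exact Relation.ReflTransGen.refl
    | append_singleton l k ih =>
      obtain ⟨h1, d0, d1, h2, h3, h4, h5⟩ := hl.snoc
      rw [mem_subW_snoc, wprod_snoc, h4]
      rintro (h | ⟨a, ha, rfl⟩)
      · exact (ih h1 u h).trans (Relation.ReflTransGen.single ⟨d0, d1, by rw [Fin.lt_def]; omega, h5, rfl⟩)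
      · exact ble_mul _ _ d0 d1 h2 h5 (ih h1 a ha)
  · intro h
    exact subW_down l h ⟨l, List.Sublist.refl _, rfl⟩

lemma exists_red_sublist (l : List ℕ) : ∃ l', l'.Sublist l ∧ Red n l' ∧ wprod n l' = wprod n l := by
  induction l using List.reverseRecOn with
  | nil => exact ⟨[], by simp, by simp [Red, wprod, invN_one], rfl⟩
  | append_singleton l k ih =>
    obtain ⟨l', h1, h2, h3⟩ := ih
    rcases simpleT_cases n k with ⟨_, h4⟩ | ⟨d0, d1, h4, h5, h6⟩
    · exact ⟨l', h1.trans (by simp), h2, by rw [wprod_snoc, h4, h3]; simp⟩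
    · rcases lt_trichotomy (wprod n l' d0) (wprod n l' d1) with h7 | h7 | h7
      · refine ⟨l' ++ [k], h1.append (List.Sublist.refl _), ?_, by rw [wprod_snoc, wprod_snoc, h3]⟩
        rw [h5]; exact h2.snoc_asc d0 d1 h4 h7
      · have := (wprod n l').injective h7
        rw [this] at h4; omega
      · obtain ⟨m, h8, h9, h10⟩ := strong_exchange l' d0 d1 (by rw [Fin.lt_def]; omega) h7
        refine ⟨m, h8.trans (h1.trans (by simp)), ?_, by rw [wprod_snoc, h10, h3, h6]⟩
        unfold Red at *
        have := invN_desc _ d0 d1 h4 h7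
        rw [h10]; omega

lemma bruhatLE_iff (u w : Perm (Fin n)) : bruhatLE n u w ↔ Ble u w := by
  constructor
  · rintro ⟨lu, lw, h1, h2, h3⟩
    rw [isReducedWord_iff] at h1 h2
    obtain ⟨rfl, h1⟩ := h1
    obtain ⟨rfl, h2⟩ := h2
    exact (subW_eq lw h2 _).1 ⟨lu, h3, rfl⟩
  · intro h
    obtain ⟨l, hl, rfl⟩ := exists_red w
    obtain ⟨l', h1, rfl⟩ := (subW_eq l hl u).2 h
    obtain ⟨m, h2, h3, h4⟩ := exists_red_sublist (n := n) l'
    exact ⟨m, l, (isReducedWord_iff _ _).2 ⟨h4, h3⟩, (isReducedWord_iff _ _).2 ⟨rfl, hl⟩, h2.trans h1⟩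

lemma one_bruhatLE (u : Perm (Fin n)) : bruhatLE n 1 u := by
  obtain ⟨l, hl, rfl⟩ := exists_red u
  exact ⟨[], l, (isReducedWord_iff _ _).2 ⟨by simp [wprod], by simp [Red, wprod, invN_one]⟩,
    (isReducedWord_iff _ _).2 ⟨rfl, hl⟩, by simp⟩

def bipV (w : Perm (Fin n)) : Set (Fin n → ℝ) := {x | ∃ u, Ble u w ∧ x = permPoint n u}

lemma BIP_eq (w : Perm (Fin n)) : BIP n 1 w = convexHull ℝ (bipV w) := by
  unfold BIP bipV
  congr 1
  ext x
  constructor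
  · rintro ⟨u, _, h, rfl⟩
    exact ⟨u, (bruhatLE_iff _ _).1 h, rfl⟩
  · rintro ⟨u, h, rfl⟩
    exact ⟨u, one_bruhatLE u, (bruhatLE_iff _ _).2 h, rfl⟩

end bruhat


section nks
open Equiv

variable {n : ℕ}

lemma sum_two {ι : Type*} [Fintype ι] [DecidableEq ι] (f g : ι → ℕ) (a b : ι) (hab : a ≠ b)
    (h : ∀ x, x ≠ a → x ≠ b → f x = g x) :
    ∑ x, f x + (g a + g b) = ∑ x, g x + (f a + f b) := by
  have h1 : ∀ F : ι → ℕ, ∑ x, F x = ∑ x ∈ Finset.univ \ {a, b}, F x + (F a + F b) := by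
    intro F
    rw [← Finset.sum_pair hab, Finset.sum_sdiff (Finset.subset_univ _)]
  have h2 : ∑ x ∈ Finset.univ \ {a, b}, f x = ∑ x ∈ Finset.univ \ {a, b}, g x := by
    apply Finset.sum_congr rfl
    intro x hx
    simp at hx
    exact h x hx.1 hx.2
  rw [h1 f, h1 g, h2]
  ring

def Lk (k : ℕ) (w : Perm (Fin n)) : Finset (Fin n) :=
  Finset.univ.filter fun x => x.val < k ∧ k ≤ (w x).val

def Rk (k : ℕ) (w : Perm (Fin n)) : Finset (Fin n) :=
  Finset.univ.filter fun x => k ≤ x.val ∧ (w x).val < k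

lemma mem_Lk {k : ℕ} {w : Perm (Fin n)} {x : Fin n} :
    x ∈ Lk k w ↔ x.val < k ∧ k ≤ (w x).val := by simp [Lk]

lemma mem_Rk {k : ℕ} {w : Perm (Fin n)} {x : Fin n} :
    x ∈ Rk k w ↔ k ≤ x.val ∧ (w x).val < k := by simp [Rk]

def nk (k : ℕ) (w : Perm (Fin n)) : ℕ := (Lk k w).card

lemma nk_sum (k : ℕ) (w : Perm (Fin n)) :
    nk k w = ∑ x : Fin n, if x.val < k ∧ k ≤ (w x).val then 1 else 0 := by
  unfold nk Lk; rw [Finset.card_filter]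

lemma card_Rk (k : ℕ) (w : Perm (Fin n)) : (Rk k w).card = nk k w := by
  have h1 : (Finset.univ.filter fun x : Fin n => x.val < k).card =
      (Finset.univ.filter fun x : Fin n => (w x).val < k).card := by
    symm
    apply Finset.card_bij (fun x _ => w x)
    · intro x hx; simpa using hx
    · intro x _ y _ h; exact w.injective h
    · intro y hy; exact ⟨w.symm y, by simpa using hy, by simp⟩
  have h2 := Finset.card_filter_add_card_filter_not (s := Finset.univ.filter fun x : Fin n => x.val < k)
    (fun x => (w x).val < k)
  have h3 := Finset.card_filter_add_card_filter_not (s := Finset.univ.filter fun x : Fin n => (w x).val < k)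
    (fun x => x.val < k)
  rw [Finset.filter_filter, Finset.filter_filter] at h2 h3
  have e1 : (Finset.univ.filter fun x : Fin n => x.val < k ∧ ¬ (w x).val < k) = Lk k w := by
    ext x; simp [Lk]
  have e2 : (Finset.univ.filter fun x : Fin n => (w x).val < k ∧ ¬ x.val < k) = Rk k w := by
    ext x; simp [Rk, and_comm]
  have e3 : (Finset.univ.filter fun x : Fin n => (w x).val < k ∧ x.val < k) =
    (Finset.univ.filter fun x : Fin n => x.val < k ∧ (w x).val < k) := by
    ext x; simp [and_comm]
  rw [e1] at h2
  rw [e2, e3] at h3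
  unfold nk
  omega

lemma nk_swap (k : ℕ) (w : Perm (Fin n)) (a b : Fin n) (hab : a ≠ b) :
    nk k (w * swap a b) + ((if a.val < k ∧ k ≤ (w a).val then 1 else 0) +
      (if b.val < k ∧ k ≤ (w b).val then 1 else 0)) = nk k w +
      ((if a.val < k ∧ k ≤ (w b).val then 1 else 0) +
      (if b.val < k ∧ k ≤ (w a).val then 1 else 0)) := by
  rw [nk_sum, nk_sum]
  have := sum_two (fun x : Fin n => if x.val < k ∧ k ≤ ((w * swap a b) x).val then 1 else 0)
    (fun x : Fin n => if x.val < k ∧ k ≤ (w x).val then 1 else 0) a b hab (by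
      intro x hx hy
      simp [swap_apply_of_ne_of_ne hx hy])
  simpa using this

lemma nk_one (k : ℕ) : nk k (1 : Perm (Fin n)) = 0 := by
  unfold nk
  rw [Finset.card_eq_zero, Finset.eq_empty_iff_forall_notMem]
  intro x hx
  rw [mem_Lk] at hx
  simp at hx; omega

lemma nk_adj (k : ℕ) (w : Perm (Fin n)) (d0 d1 : Fin n) (h : d0.val + 1 = d1.val)
    (hk : k ≠ d1.val) : nk k (w * swap d0 d1) = nk k w := by
  have := nk_swap k w d0 d1 (by rintro rfl; omega)
  split_ifs at this <;> omega

lemma nk_adj' (w : Perm (Fin n)) (d0 d1 : Fin n) (h : d0.val + 1 = d1.val) :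
    nk d1.val (w * swap d0 d1) + (if d1.val ≤ (w d0).val then 1 else 0) =
    nk d1.val w + (if d1.val ≤ (w d1).val then 1 else 0) := by
  have := nk_swap d1.val w d0 d1 (by rintro rfl; omega)
  split_ifs at this ⊢ <;> omega

lemma nk_cov (k : ℕ) {x y : Perm (Fin n)} (h : Cov x y) : nk k x ≤ nk k y := by
  obtain ⟨a, b, hab, hx, rfl⟩ := h
  have := nk_swap k x a b hab.ne
  rw [Fin.lt_def] at hab hx
  split_ifs at this <;> omega

lemma nk_mono (k : ℕ) {x y : Perm (Fin n)} (h : Ble x y) : nk k x ≤ nk k y := by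
  induction h with
  | refl => exact le_rfl
  | tail _ h ih => exact ih.trans (nk_cov k h)

lemma nk_mul_simple (k j : ℕ) (w : Perm (Fin n)) :
    nk k (w * simpleT n j) ≤ nk k w + (if j = k then 1 else 0) := by
  rcases simpleT_cases n j with ⟨_, h3⟩ | ⟨d0, d1, h3, h4, h5⟩
  · rw [h3]; simp
  · rw [h5]
    by_cases hk : k = d1.val
    · have := nk_adj' w d0 d1 h3
      rw [← hk] at this
      split_ifs at this ⊢ <;> omega
    · rw [nk_adj k w d0 d1 h3 hk]; simp

lemma nk_wprod (k : ℕ) (l : List ℕ) : nk k (wprod n l) ≤ l.count k := by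
  induction l using List.reverseRecOn with
  | nil => simp [wprod, nk_one]
  | append_singleton l j ih =>
    rw [wprod_snoc, List.count_append]
    have := nk_mul_simple k j (wprod n l)
    rw [List.count_singleton]
    simp only [beq_iff_eq]
    omega

def Dd (w : Perm (Fin n)) : ℕ := ∑ k ∈ Finset.range n, nk k w

lemma Dd_mul_simple (j : ℕ) (w : Perm (Fin n)) : Dd (w * simpleT n j) ≤ Dd w + 1 := by
  unfold Dd
  calc _ ≤ ∑ k ∈ Finset.range n, (nk k w + (if j = k then 1 else 0)) :=
        Finset.sum_le_sum fun k _ => nk_mul_simple k j w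
    _ ≤ _ := by
        rw [Finset.sum_add_distrib, Finset.sum_ite_eq]
        split_ifs <;> omega

lemma Dd_wprod (l : List ℕ) : Dd (wprod n l) ≤ l.length := by
  induction l using List.reverseRecOn with
  | nil => simp [wprod, Dd, nk_one]
  | append_singleton l j ih =>
    rw [wprod_snoc]
    have := Dd_mul_simple j (wprod n l)
    simp; omega

lemma Dd_le (w : Perm (Fin n)) : Dd w ≤ invN w := by
  obtain ⟨l, hl, rfl⟩ := exists_red w
  rw [← hl]; exact Dd_wprod l

def Av321 (w : Perm (Fin n)) : Prop := ∀ a b c, a < b → b < c → w b < w a → w c < w b → False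

lemma desc_of_Dd (w : Perm (Fin n)) (hw : invN w = Dd w) (d0 d1 : Fin n) (h : d0.val + 1 = d1.val)
    (hd : w d1 < w d0) : (w d1).val ≤ d0.val ∧ d0.val < (w d0).val ∧
      invN (w * swap d0 d1) = Dd (w * swap d0 d1) := by
  have h1 := invN_desc w d0 d1 h hd
  have h2 := Dd_le (w * swap d0 d1)
  have h3 : Dd (w * swap d0 d1) + (if d1.val ≤ (w d0).val then 1 else 0) =
    Dd w + (if d1.val ≤ (w d1).val then 1 else 0) := by
    unfold Dd
    have hm : d1.val ∈ Finset.range n := by simp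
    rw [← Finset.add_sum_erase _ _ hm, ← Finset.add_sum_erase _ _ hm]
    have := nk_adj' w d0 d1 h
    rw [Finset.sum_congr rfl (fun k hk => nk_adj k w d0 d1 h (Finset.ne_of_mem_erase hk))]
    omega
  rw [Fin.lt_def] at hd
  split_ifs at h3 <;> omega

lemma av321_of_Dd : ∀ (N : ℕ) (w : Perm (Fin n)), invN w = N → invN w = Dd w → Av321 w := by
  intro N
  induction N with
  | zero =>
    intro w hw _ a b c hab hbc h1 h2
    unfold invN at hw
    rw [Finset.card_eq_zero] at hw
    have : (a, b) ∈ invSet w := (mem_invSet _ _).2 ⟨hab, h1⟩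
    rw [hw] at this; simp at this
  | succ N ih =>
    intro w hN hD
    have hne : w ≠ 1 := by
      rintro rfl
      rw [invN_one] at hN; omega
    obtain ⟨d0, d1, h, h'⟩ := exists_descent w hne
    obtain ⟨e1, e2, e3⟩ := desc_of_Dd w hD d0 d1 h h'
    have IH := ih _ (by have := invN_desc w d0 d1 h h'; omega) e3
    -- occurrences not using both
    have key : ∀ a b c, a < b → b < c → w b < w a → w c < w b → ¬ (a = d0 ∧ b = d1) →
        ¬ (b = d0 ∧ c = d1) → False := by
      intro a b c hab hbc h1 h2 h3 h4
      have g : ∀ x y : Fin n, x < y → ¬ (x = d0 ∧ y = d1) → swap d0 d1 x < swap d0 d1 y := by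
        intro x y hxy hn
        refine (swap_lt_iff d0 d1 h x y hn ?_).2 hxy
        rintro ⟨rfl, rfl⟩
        rw [Fin.lt_def] at hxy; omega
      exact IH _ _ _ (g a b hab h3) (g b c hbc h4) (by simpa using h1) (by simpa using h2)
    intro a b c hab hbc h1 h2
    by_cases h3 : a = d0 ∧ b = d1
    · obtain ⟨rfl, rfl⟩ := h3
      have hb : b ∈ Rk b.val w := mem_Rk.2 ⟨le_rfl, by omega⟩
      have hc : c ∈ Rk b.val w := mem_Rk.2 ⟨hbc.le, by rw [Fin.lt_def] at h2; omega⟩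
      have : 1 < nk b.val w := by
        rw [← card_Rk]; exact Finset.one_lt_card.2 ⟨b, hb, c, hc, hbc.ne⟩
      obtain ⟨x, hx, hxa⟩ := Finset.exists_mem_ne this a
      rw [mem_Lk] at hx
      refine key x b c hx.1 hbc ?_ h2 (by tauto) ?_
      · rw [Fin.lt_def]; omega
      · rintro ⟨rfl, -⟩; exact absurd hab (lt_irrefl _)
    · by_cases h4 : b = d0 ∧ c = d1
      · obtain ⟨rfl, rfl⟩ := h4
        have hb : b ∈ Lk c.val w := mem_Lk.2 ⟨hbc, by omega⟩
        have hc : a ∈ Lk c.val w := mem_Lk.2 ⟨hab.trans hbc, by rw [Fin.lt_def] at h1; omega⟩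
        have : 1 < nk c.val w := Finset.one_lt_card.2 ⟨b, hb, a, hc, hab.ne'⟩
        rw [← card_Rk] at this
        obtain ⟨x, hx, hxa⟩ := Finset.exists_mem_ne this c
        rw [mem_Rk] at hx
        refine key a b x hab ?_ h1 ?_ h3 (by tauto)
        · rw [Fin.lt_def]; omega
        · rw [Fin.lt_def]; omega
      · exact key a b c hab hbc h1 h2 h3 h4

lemma desc_of_av (w : Perm (Fin n)) (hw : Av321 w) (d0 d1 : Fin n) (h : d0.val + 1 = d1.val)
    (hd : w d1 < w d0) : (w d1).val ≤ d0.val ∧ d0.val < (w d0).val := by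
  have hlt : d0 < d1 := by rw [Fin.lt_def]; omega
  constructor
  · have : (Finset.Iio (w d1)).card ≤ (Finset.Iio d0).card := by
      apply Finset.card_le_card_of_injOn w.symm
      · intro v hv
        have hv : v < w d1 := by simpa using hv
        have hv2 : w (w.symm v) = v := by simp
        simp only [Finset.coe_Iio, Set.mem_Iio]
        by_contra hcon
        push Not at hcon
        have n1 : w.symm v ≠ d0 := by rintro h; rw [h] at hv2; rw [← hv2] at hv; exact absurd hv (not_lt.2 hd.le)
        have n2 : w.symm v ≠ d1 := by rintro h; rw [h] at hv2; rw [← hv2] at hv; exact absurd hv (lt_irrefl _)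
        refine hw d0 d1 (w.symm v) hlt ?_ hd (by rw [hv2]; exact hv)
        rw [Fin.ne_iff_vne] at n1 n2
        rw [Fin.le_def] at hcon
        rw [Fin.lt_def]; omega
      · exact w.symm.injective.injOn
    simpa using this
  · have : ((Finset.Iic d1).erase d0).card ≤ (Finset.Iio (w d0)).card := by
      apply Finset.card_le_card_of_injOn w
      · intro x hx
        have hx : x ≠ d0 ∧ x ≤ d1 := by simpa [and_comm] using hx
        simp only [Finset.coe_Iio, Set.mem_Iio]
        by_cases hx1 : x = d1
        · rw [hx1]; exact hd
        · by_contra hcon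
          have : w x ≠ w d0 := fun h => hx.1 (w.injective h)
          refine hw x d0 d1 ?_ hlt (lt_of_le_of_ne (not_lt.1 hcon) this.symm) hd
          obtain ⟨h1, h2⟩ := hx
          rw [ne_eq] at h1
          rw [Fin.ext_iff] at h1 hx1
          rw [Fin.le_def] at h2
          rw [Fin.lt_def]; omega
      · exact w.injective.injOn
    rw [Finset.card_erase_of_mem (by simp [hlt.le])] at this
    simp at this
    omega

lemma av_peel (w : Perm (Fin n)) (hw : Av321 w) (d0 d1 : Fin n) (h : d0.val + 1 = d1.val)
    (hd : w d1 < w d0) : Av321 (w * swap d0 d1) ∧ nk d1.val (w * swap d0 d1) + 1 = nk d1.val w ∧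
      ∀ k ≠ d1.val, nk k (w * swap d0 d1) = nk k w := by
  obtain ⟨h1, h2⟩ := desc_of_av w hw d0 d1 h hd
  refine ⟨?_, ?_, fun k hk => nk_adj k w d0 d1 h hk⟩
  · intro a b c hab hbc h3 h4
    have g : ∀ x y : Fin n, x < y → (w * swap d0 d1) y < (w * swap d0 d1) x →
        swap d0 d1 x < swap d0 d1 y := by
      intro x y hxy hn
      refine (swap_lt_iff d0 d1 h x y ?_ ?_).2 hxy
      · rintro ⟨rfl, rfl⟩
        simp at hn
        exact absurd hn (not_lt.2 hd.le)
      · rintro ⟨rfl, rfl⟩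
        rw [Fin.lt_def] at hxy; omega
    exact hw _ _ _ (g a b hab h3) (g b c hbc h4) h3 h4
  · have := nk_adj' w d0 d1 h
    rw [if_pos (by omega), if_neg (by omega)] at this
    omega

def Occ (w : Perm (Fin n)) (a b c d : Fin n) : Prop :=
  a < b ∧ b < c ∧ c < d ∧ w c < w d ∧ w d < w a ∧ w a < w b

lemma patOcc_iff (w : Perm (Fin n)) (j : Fin 4 → Fin n) :
    IsPatternOcc w pattern3412 j ↔ Occ w (j 0) (j 1) (j 2) (j 3) := by
  have p0 : pattern3412 0 = 2 := by decide
  have p1 : pattern3412 1 = 3 := by decide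
  have p2 : pattern3412 2 = 0 := by decide
  have p3 : pattern3412 3 = 1 := by decide
  constructor
  · rintro ⟨h1, h2⟩
    refine ⟨h1 (by decide), h1 (by decide), h1 (by decide), (h2 _ _).2 (by decide),
      (h2 _ _).2 (by decide), (h2 _ _).2 (by decide)⟩
  · rintro ⟨h1, h2, h3, h4, h5, h6⟩
    constructor
    · rw [Fin.strictMono_iff_lt_succ]
      intro i
      fin_cases i
      · exact h1
      · exact h2
      · exact h3
    · simp only [Fin.forall_fin_succ, Fin.lt_def] at *
      simp [p0, p1, p2, p3]
      omega

lemma av321_iff (w : Perm (Fin n)) : AvoidsPattern w pattern321 ↔ Av321 w := by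
  have p0 : pattern321 0 = 2 := by decide
  have p1 : pattern321 1 = 1 := by decide
  have p2 : pattern321 2 = 0 := by decide
  constructor
  · intro h a b c hab hbc h1 h2
    apply h
    refine ⟨![a, b, c], ?_, ?_⟩
    · rw [Fin.strictMono_iff_lt_succ]
      intro i
      fin_cases i
      · exact hab
      · exact hbc
    · simp only [Fin.forall_fin_succ, Fin.lt_def] at *
      simp [p0, p1, p2]
      omega
  · rintro h ⟨j, h1, h2⟩
    exact h (j 0) (j 1) (j 2) (h1 (by decide)) (h1 (by decide)) ((h2 _ _).2 (by decide))
      ((h2 _ _).2 (by decide))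

lemma once_iff (w : Perm (Fin n)) : ContainsPatternOnce w pattern3412 ↔
    (∃ a b c d, Occ w a b c d) ∧ ∀ a b c d a' b' c' d', Occ w a b c d → Occ w a' b' c' d' →
      a = a' ∧ b = b' ∧ c = c' ∧ d = d' := by
  constructor
  · rintro ⟨j, h1, h2⟩
    rw [patOcc_iff] at h1
    refine ⟨⟨_, _, _, _, h1⟩, ?_⟩
    intro a b c d a' b' c' d' h h'
    have e1 := h2 ![a, b, c, d] ((patOcc_iff _ _).2 h)
    have e2 := h2 ![a', b', c', d'] ((patOcc_iff _ _).2 h')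
    have e := e1.trans e2.symm
    exact ⟨congrFun e 0, congrFun e 1, congrFun e 2, congrFun e 3⟩
  · rintro ⟨⟨a, b, c, d, h⟩, h2⟩
    refine ⟨![a, b, c, d], (patOcc_iff _ _).2 h, ?_⟩
    intro j hj
    rw [patOcc_iff] at hj
    obtain ⟨e1, e2, e3, e4⟩ := h2 _ _ _ _ _ _ _ _ hj h
    funext i
    fin_cases i
    · exact e1
    · exact e2
    · exact e3
    · exact e4

lemma occ_of_LR (w : Perm (Fin n)) (hw : Av321 w) (k : ℕ) {a b c d : Fin n} (ha : a ∈ Lk k w)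
    (hb : b ∈ Lk k w) (hc : c ∈ Rk k w) (hd : d ∈ Rk k w) (hab : a < b) (hcd : c < d) :
    Occ w a b c d := by
  rw [mem_Lk] at ha hb
  rw [mem_Rk] at hc hd
  have hbc : b < c := by rw [Fin.lt_def]; omega
  have hda : w d < w a := by rw [Fin.lt_def]; omega
  refine ⟨hab, hbc, hcd, ?_, hda, ?_⟩
  · by_contra hcon
    rcases lt_or_eq_of_le (not_lt.1 hcon) with h | h
    · exact hw b c d hbc hcd (by rw [Fin.lt_def]; omega) h
    · exact absurd (w.injective h) hcd.ne'
  · by_contra hcon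
    rcases lt_or_eq_of_le (not_lt.1 hcon) with h | h
    · exact hw a b c hab hbc h (by rw [Fin.lt_def]; omega)
    · exact absurd (w.injective h) hab.ne'

lemma two_le_of_lt {s : Finset (Fin n)} (h : 1 < s.card) : ∃ a ∈ s, ∃ b ∈ s, a < b := by
  obtain ⟨a, ha, b, hb, hne⟩ := Finset.one_lt_card.1 h
  rcases lt_or_gt_of_ne hne with h | h
  · exact ⟨a, ha, b, hb, h⟩
  · exact ⟨b, hb, a, ha, h⟩

lemma occ_cut1 (w : Perm (Fin n)) {a b c d : Fin n} (h : Occ w a b c d) :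
    1 < nk (min (w a).val c.val) w := by
  obtain ⟨h1, h2, h3, h4, h5, h6⟩ := h
  simp only [Fin.lt_def] at *
  rcases le_or_gt (w a).val c.val with hc | hc
  · rw [min_eq_left hc, ← card_Rk]
    exact Finset.one_lt_card.2 ⟨c, mem_Rk.2 (by omega), d, mem_Rk.2 (by omega), by
      rintro rfl; omega⟩
  · rw [min_eq_right hc.le]
    exact Finset.one_lt_card.2 ⟨a, mem_Lk.2 (by omega), b, mem_Lk.2 (by omega), by
      rintro rfl; omega⟩

lemma occ_cut2 (w : Perm (Fin n)) {a b c d : Fin n} (h : Occ w a b c d) :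
    1 < nk (max b.val (w d).val + 1) w := by
  obtain ⟨h1, h2, h3, h4, h5, h6⟩ := h
  simp only [Fin.lt_def] at *
  rcases le_or_gt b.val (w d).val with hc | hc
  · rw [max_eq_right hc]
    exact Finset.one_lt_card.2 ⟨a, mem_Lk.2 (by omega), b, mem_Lk.2 (by omega), by
      rintro rfl; omega⟩
  · rw [max_eq_left hc.le, ← card_Rk]
    exact Finset.one_lt_card.2 ⟨c, mem_Rk.2 (by omega), d, mem_Rk.2 (by omega), by
      rintro rfl; omega⟩

def Cl (w : Perm (Fin n)) (i : ℕ) : Prop := Av321 w ∧ nk i w = 2 ∧ ∀ k ≠ i, nk k w ≤ 1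

lemma sorted_two {s : Finset (Fin n)} (h : s.card = 2) {a b a' b' : Fin n} (ha : a ∈ s)
    (hb : b ∈ s) (ha' : a' ∈ s) (hb' : b' ∈ s) (hab : a < b) (hab' : a' < b') :
    a = a' ∧ b = b' := by
  obtain ⟨x, y, hxy, rfl⟩ := Finset.card_eq_two.1 h
  simp only [Finset.mem_insert, Finset.mem_singleton] at *
  simp only [Fin.lt_def, Fin.ext_iff] at *
  omega

lemma pattern_iff (w : Perm (Fin n)) :
    ContainsPatternOnce w pattern3412 ∧ AvoidsPattern w pattern321 ↔ ∃ i, Cl w i := by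
  rw [once_iff, av321_iff]
  constructor
  · rintro ⟨⟨⟨a, b, c, d, ho⟩, hu⟩, hw⟩
    have main : ∀ k, 1 < nk k w → Lk k w = {a, b} ∧ Rk k w = {c, d} := by
      intro k hk
      obtain ⟨x, hx, y, hy, hxy⟩ := two_le_of_lt hk
      have hk' := hk
      rw [← card_Rk] at hk'
      obtain ⟨z, hz, t, ht, hzt⟩ := two_le_of_lt hk'
      obtain ⟨e1, e2, e3, e4⟩ := hu _ _ _ _ _ _ _ _ (occ_of_LR w hw k hx hy hz ht hxy hzt) ho
      subst e1 e2 e3 e4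
      constructor
      · ext m
        simp only [Finset.mem_insert, Finset.mem_singleton]
        constructor
        · intro hm
          by_contra hcon
          push Not at hcon
          rcases lt_or_gt_of_ne hcon.1 with h | h
          · have := hu _ _ _ _ _ _ _ _ (occ_of_LR w hw k hm hx hz ht h hzt) ho
            exact hcon.1 this.1
          · have := hu _ _ _ _ _ _ _ _ (occ_of_LR w hw k hx hm hz ht h hzt) ho
            exact hcon.2 this.2.1
        · rintro (rfl | rfl) <;> assumption
      · ext m
        simp only [Finset.mem_insert, Finset.mem_singleton]
        constructor
        · intro hm
          by_contra hcon
          push Not at hcon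
          rcases lt_or_gt_of_ne hcon.1 with h | h
          · have := hu _ _ _ _ _ _ _ _ (occ_of_LR w hw k hx hy hm hz hxy h) ho
            exact hcon.1 this.2.2.1
          · have := hu _ _ _ _ _ _ _ _ (occ_of_LR w hw k hx hy hz hm hxy h) ho
            exact hcon.2 this.2.2.2
        · rintro (rfl | rfl) <;> assumption
    have nolt : ∀ k k', k < k' → 1 < nk k w → 1 < nk k' w → False := by
      intro k k' hkk h1 h2
      obtain ⟨l1, r1⟩ := main k h1
      obtain ⟨l2, r2⟩ := main k' h2
      have a1 : a ∈ Lk k w := by rw [l1]; simp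
      have a2 : a ∈ Lk k' w := by rw [l2]; simp
      have c1 : c ∈ Rk k w := by rw [r1]; simp
      have c2 : c ∈ Rk k' w := by rw [r2]; simp
      let m : Fin n := ⟨k, by have := mem_Rk.1 c2; have := c.2; omega⟩
      have hm : m.val = k := rfl
      have m1 : m ∉ Rk k w := by
        rw [r1, ← r2, mem_Rk]; omega
      have m2 : m ∉ Lk k' w := by
        rw [l2, ← l1, mem_Lk]; omega
      rw [mem_Lk] at a1 a2 m2
      rw [mem_Rk] at c1 c2 m1
      refine hw a m c ?_ ?_ ?_ ?_ <;> rw [Fin.lt_def] <;> omega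
    refine ⟨min (w a).val c.val, hw, ?_, ?_⟩
    · have h1 := occ_cut1 w ho
      unfold nk
      rw [(main _ h1).1, Finset.card_pair ho.1.ne]
    · intro k hk
      by_contra hcon
      rcases lt_or_gt_of_ne hk with h | h
      · exact nolt _ _ h (not_le.1 hcon) (occ_cut1 w ho)
      · exact nolt _ _ h (occ_cut1 w ho) (not_le.1 hcon)
  · rintro ⟨i, hw, hi, hk⟩
    have hi' := hi
    rw [← card_Rk] at hi'
    have key : ∀ a b c d, Occ w a b c d → (a ∈ Lk i w ∧ b ∈ Lk i w) ∧ c ∈ Rk i w ∧ d ∈ Rk i w := by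
      intro a b c d ho
      have h1 := occ_cut1 w ho
      have h2 := occ_cut2 w ho
      have e1 : min (w a).val c.val = i := by
        by_contra h; have := hk _ h; omega
      have e2 : max b.val (w d).val + 1 = i := by
        by_contra h; have := hk _ h; omega
      obtain ⟨h1, h2, h3, h4, h5, h6⟩ := ho
      simp only [mem_Lk, mem_Rk, Fin.lt_def] at *
      omega
    refine ⟨⟨?_, ?_⟩, hw⟩
    · obtain ⟨x, hx, y, hy, hxy⟩ := two_le_of_lt (s := Lk i w) (by unfold nk at hi; omega)
      obtain ⟨z, hz, t, ht, hzt⟩ := two_le_of_lt (s := Rk i w) (by omega)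
      exact ⟨_, _, _, _, occ_of_LR w hw i hx hy hz ht hxy hzt⟩
    · intro a b c d a' b' c' d' h h'
      obtain ⟨⟨q1, q2⟩, q3, q4⟩ := key _ _ _ _ h
      obtain ⟨⟨q1', q2'⟩, q3', q4'⟩ := key _ _ _ _ h'
      obtain ⟨e1, e2⟩ := sorted_two hi q1 q2 q1' q2' h.1 h'.1
      obtain ⟨e3, e4⟩ := sorted_two hi' q3 q4 q3' q4' h.2.2.1 h'.2.2.1
      exact ⟨e1, e2, e3, e4⟩

end nks


section block
open Equiv

variable {n : ℕ}

lemma nk_zero_iff {k : ℕ} {a : Perm (Fin n)} (h : nk k a = 0) (x : Fin n) :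
    (a x).val < k ↔ x.val < k := by
  have h1 : Lk k a = ∅ := Finset.card_eq_zero.1 h
  have h2 : Rk k a = ∅ := by rw [← Finset.card_eq_zero, card_Rk, h]
  have h3 : x ∉ Lk k a := by simp [h1]
  have h4 : x ∉ Rk k a := by simp [h2]
  rw [mem_Lk] at h3
  rw [mem_Rk] at h4
  omega

noncomputable def bpi (lo hi : Fin n) (y : Fin n → ℝ) : Fin n → ℝ := fun m =>
  if m < lo ∨ hi < m then y m else
  if m = lo then (∑ m : Fin n, if m ≤ lo then ((m.val : ℝ) + 1) else 0) -
    ∑ m : Fin n, (if m < lo then y m else 0) else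
  if m = hi then (∑ m : Fin n, if hi ≤ m then ((m.val : ℝ) + 1) else 0) -
    ∑ m : Fin n, (if hi < m then y m else 0) else (m.val : ℝ) + 1

def Blk (lo hi : Fin n) (x : Fin n → ℝ) : Prop :=
  x lo ≤ lo.val + 1 ∧ (hi.val : ℝ) + 1 ≤ x hi ∧ ∀ m, lo < m → m < hi → x m = (m.val : ℝ) + 1

lemma sum_lo (lo : Fin n) (a : Perm (Fin n)) (h : nk (lo.val + 1) a = 0) :
    (∑ m : Fin n, if m ≤ lo then permPoint n a m else 0) =
      ∑ m : Fin n, if m ≤ lo then ((m.val : ℝ) + 1) else 0 := by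
  rw [← Equiv.sum_comp a (fun m : Fin n => if m ≤ lo then ((m.val : ℝ) + 1) else 0)]
  apply Finset.sum_congr rfl
  intro m _
  have := nk_zero_iff h m
  have e : a m ≤ lo ↔ m ≤ lo := by rw [Fin.le_def, Fin.le_def]; omega
  simp only [e]
  rfl

lemma sum_hi (hi : Fin n) (a : Perm (Fin n)) (h : nk hi.val a = 0) :
    (∑ m : Fin n, if hi ≤ m then permPoint n a m else 0) =
      ∑ m : Fin n, if hi ≤ m then ((m.val : ℝ) + 1) else 0 := by
  rw [← Equiv.sum_comp a (fun m : Fin n => if hi ≤ m then ((m.val : ℝ) + 1) else 0)]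
  apply Finset.sum_congr rfl
  intro m _
  have := nk_zero_iff h m
  have e : hi ≤ a m ↔ hi ≤ m := by rw [Fin.le_def, Fin.le_def]; omega
  simp only [e]
  rfl

lemma sum_lo_split (lo : Fin n) (f : Fin n → ℝ) : (∑ m : Fin n, if m ≤ lo then f m else 0) =
    f lo + ∑ m : Fin n, if m < lo then f m else 0 := by
  have : f lo = ∑ m : Fin n, if m = lo then f m else 0 := by simp
  rw [this, ← Finset.sum_add_distrib]
  apply Finset.sum_congr rfl
  intro m _
  rcases lt_trichotomy m lo with h | h | h
  · simp [h, h.le, h.ne]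
  · simp [h]
  · simp [h.ne', not_le.2 h, not_lt.2 h.le]

lemma sum_hi_split (hi : Fin n) (f : Fin n → ℝ) : (∑ m : Fin n, if hi ≤ m then f m else 0) =
    f hi + ∑ m : Fin n, if hi < m then f m else 0 := by
  have : f hi = ∑ m : Fin n, if m = hi then f m else 0 := by simp
  rw [this, ← Finset.sum_add_distrib]
  apply Finset.sum_congr rfl
  intro m _
  rcases lt_trichotomy m hi with h | h | h
  · simp [h.ne, not_le.2 h, not_lt.2 h.le]
  · simp [h]
  · simp [h, h.le, h.ne']

lemma sum_aff (P : Fin n → Prop) [DecidablePred P] (y z : Fin n → ℝ) (t : ℝ) :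
    (∑ m : Fin n, if P m then (y + t • (z - y)) m else 0) =
    (∑ m : Fin n, if P m then y m else 0) + t * ((∑ m : Fin n, if P m then z m else 0) -
      (∑ m : Fin n, if P m then y m else 0)) := by
  rw [← Finset.sum_sub_distrib, Finset.mul_sum, ← Finset.sum_add_distrib]
  apply Finset.sum_congr rfl
  intro m _
  by_cases h : P m <;> simp [h]

lemma bpi_aff (lo hi : Fin n) (y z : Fin n → ℝ) (t : ℝ) :
    bpi lo hi (y + t • (z - y)) = bpi lo hi y + t • (bpi lo hi z - bpi lo hi y) := by
  funext m
  simp only [bpi, Pi.add_apply, Pi.smul_apply, Pi.sub_apply, smul_eq_mul]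
  split_ifs
  · rfl
  · have := sum_aff (fun m => m < lo) y z t
    simp only [Pi.add_apply, Pi.smul_apply, Pi.sub_apply, smul_eq_mul] at this
    rw [this]; ring
  · have := sum_aff (fun m => hi < m) y z t
    simp only [Pi.add_apply, Pi.smul_apply, Pi.sub_apply, smul_eq_mul] at this
    rw [this]; ring
  · ring

lemma blk_vertex (lo hi : Fin n) (hlt : lo < hi) (a : Perm (Fin n))
    (hnk : ∀ k, lo.val < k → k ≤ hi.val → nk k a = 0) : Blk lo hi (permPoint n a) := by
  rw [Fin.lt_def] at hlt
  have h1 := nk_zero_iff (hnk (lo.val + 1) (by omega) (by omega)) lo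
  have h2 := nk_zero_iff (hnk hi.val (by omega) (by omega)) hi
  refine ⟨?_, ?_, ?_⟩
  · have : (a lo).val ≤ lo.val := by omega
    have : ((a lo).val : ℝ) ≤ lo.val := by exact_mod_cast this
    unfold permPoint; linarith
  · have : hi.val ≤ (a hi).val := by omega
    have : (hi.val : ℝ) ≤ (a hi).val := by exact_mod_cast this
    unfold permPoint; linarith
  · intro m hm1 hm2
    rw [Fin.lt_def] at hm1 hm2
    have h3 := nk_zero_iff (hnk (m.val + 1) (by omega) (by omega)) m
    have h4 := nk_zero_iff (hnk (m.val) (by omega) (by omega)) m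
    have : (a m).val = m.val := by omega
    unfold permPoint; rw [this]

lemma bpi_vertex (lo hi : Fin n) (hlt : lo < hi) (a b : Perm (Fin n))
    (hnk : ∀ k, lo.val < k → k ≤ hi.val → nk k a = 0)
    (hb : ∀ m, m < lo ∨ hi < m → b m = m) :
    bpi lo hi (fun m => permPoint n a (b m)) = permPoint n a := by
  have hlt' := hlt
  rw [Fin.lt_def] at hlt'
  obtain ⟨-, -, h3⟩ := blk_vertex lo hi hlt a hnk
  funext m
  unfold bpi
  split_ifs with c1 c2 c3
  · show permPoint n a (b m) = _
    rw [hb m c1]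
  · rw [← sum_lo lo a (hnk _ (by omega) (by omega)), sum_lo_split, c2]
    have : (∑ m : Fin n, if m < lo then permPoint n a (b m) else 0) =
      ∑ m : Fin n, if m < lo then permPoint n a m else 0 := by
      apply Finset.sum_congr rfl
      intro m _
      split_ifs with h
      · rw [hb m (Or.inl h)]
      · rfl
    rw [this]; ring
  · rw [← sum_hi hi a (hnk _ (by omega) (by omega)), sum_hi_split, c3]
    have : (∑ m : Fin n, if hi < m then permPoint n a (b m) else 0) =
      ∑ m : Fin n, if hi < m then permPoint n a m else 0 := by
      apply Finset.sum_congr rfl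
      intro m _
      split_ifs with h
      · rw [hb m (Or.inr h)]
      · rfl
    rw [this]; ring
  · rw [h3 m]
    · rcases lt_trichotomy m lo with h | h | h
      · exact absurd (Or.inl h) c1
      · exact absurd h c2
      · exact h
    · rcases lt_trichotomy m hi with h | h | h
      · exact h
      · exact absurd h c3
      · exact absurd (Or.inr h) c1

lemma blk_convex (lo hi : Fin n) : Convex ℝ {x | Blk lo hi x} := by
  rintro x ⟨h1, h2, h3⟩ y ⟨h1', h2', h3'⟩ a b ha hb hab
  refine ⟨?_, ?_, ?_⟩
  · simp only [Pi.add_apply, Pi.smul_apply, smul_eq_mul]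
    have : b = 1 - a := by linarith
    subst this
    nlinarith
  · simp only [Pi.add_apply, Pi.smul_apply, smul_eq_mul]
    have : b = 1 - a := by linarith
    subst this
    nlinarith
  · intro m hm hm'
    simp only [Pi.add_apply, Pi.smul_apply, smul_eq_mul]
    rw [h3 m hm hm', h3' m hm hm', ← add_mul, hab, one_mul]

lemma block_step {ι J K JK : Type} (lo hi : Fin n) (hlt : lo < hi) (w' w : Perm (Fin n))
    {I : ι → J → Prop} (h : Realizes I (bipV w'))
    (hnk : ∀ k, lo.val < k → k ≤ hi.val → nk k w' = 0) (b : K → Perm (Fin n))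
    (hb : ∀ k m, m < lo ∨ hi < m → b k m = m)
    (hw : ∀ u, Ble u w ↔ ∃ a, Ble a w' ∧ ∃ k, u = a * b k)
    (IK : K → JK → Prop) (g : JK → (Fin n → ℝ) → (Fin n → ℝ) → ℝ)
    (hg : ∀ j y z x x' (t : ℝ), g j (y + t • (z - y)) (x + t • (x' - x)) =
      g j y x + t * (g j z x' - g j y x))
    (hgpos : ∀ k j x, Blk lo hi x → 0 ≤ g j (fun m => x (b k m)) x)
    (hgI : ∀ k j x, Blk lo hi x → (IK k j ↔ g j (fun m => x (b k m)) x = 0))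
    (hcomp : ∀ y x, Blk lo hi x → (∀ m, m < lo ∨ hi < m → y m = x m) →
      ∑ m, y m = ∑ m, x m → (∀ j, 0 ≤ g j y x) →
      y ∈ convexHull ℝ (Set.range fun k => (fun m => x (b k m)))) :
    Realizes (prodI I IK) (bipV w) := by
  have hT : ∀ a : Perm (Fin n), ∑ m, permPoint n a m = ∑ m : Fin n, ((m.val : ℝ) + 1) := by
    intro a
    rw [← Equiv.sum_comp a (fun m : Fin n => ((m.val : ℝ) + 1))]; rfl
  have hnk' : ∀ a, Ble a w' → ∀ k, lo.val < k → k ≤ hi.val → nk k a = 0 := by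
    intro a ha k h1 h2
    have := nk_mono k ha
    rw [hnk k h1 h2] at this
    omega
  have hset : bipV w = {y | ∃ x ∈ bipV w', ∃ k, y = (LinearMap.funLeft ℝ ℝ (b k)) x} := by
    ext y
    constructor
    · rintro ⟨u, hu, rfl⟩
      obtain ⟨a, ha, k, rfl⟩ := (hw u).1 hu
      exact ⟨_, ⟨a, ha, rfl⟩, k, rfl⟩
    · rintro ⟨_, ⟨a, ha, rfl⟩, k, rfl⟩
      exact ⟨a * b k, (hw _).2 ⟨a, ha, k, rfl⟩, rfl⟩
  rw [hset]
  have hsumaff : ∀ (y z : Fin n → ℝ) (t : ℝ), ∑ m, (y + t • (z - y)) m =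
      ∑ m, y m + t * (∑ m, z m - ∑ m, y m) := by
    intro y z t
    have := sum_aff (fun _ => True) y z t
    simpa using this
  refine h.twist IK (fun k => LinearMap.funLeft ℝ ℝ (b k)) (bpi lo hi)
    {y | ∑ m, y m = ∑ m : Fin n, ((m.val : ℝ) + 1)} (fun j y => g j y (bpi lo hi y))
    (bpi_aff lo hi) ?_ ?_ ?_ ?_ ?_ ?_ ?_
  · intro y hy z hz t
    have hy' : ∑ m, y m = ∑ m : Fin n, ((m.val : ℝ) + 1) := hy
    have hz' : ∑ m, z m = ∑ m : Fin n, ((m.val : ℝ) + 1) := hz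
    show ∑ m, (y + t • (z - y)) m = ∑ m : Fin n, ((m.val : ℝ) + 1)
    rw [hsumaff, hy', hz']; ring
  · intro j y z t
    show g j _ _ = _
    rw [bpi_aff, hg]
  · rintro k _ ⟨a, ha, rfl⟩
    exact bpi_vertex lo hi hlt a (b k) (hnk' a ha) (hb k)
  · rintro k _ ⟨a, ha, rfl⟩
    exact hT (a * b k)
  · rintro k j _ ⟨a, ha, rfl⟩
    have e : bpi lo hi ((LinearMap.funLeft ℝ ℝ (b k)) (permPoint n a)) = permPoint n a :=
      bpi_vertex lo hi hlt a (b k) (hnk' a ha) (hb k)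
    show 0 ≤ g j _ _
    rw [e]
    exact hgpos k j _ (blk_vertex lo hi hlt a (hnk' a ha))
  · rintro k j _ ⟨a, ha, rfl⟩
    have e : bpi lo hi ((LinearMap.funLeft ℝ ℝ (b k)) (permPoint n a)) = permPoint n a :=
      bpi_vertex lo hi hlt a (b k) (hnk' a ha) (hb k)
    show _ ↔ g j _ _ = 0
    rw [e]
    exact hgI k j _ (blk_vertex lo hi hlt a (hnk' a ha))
  · intro y hy hpy hj
    have hsub : convexHull ℝ (bipV w') ⊆ {x | Blk lo hi x} ∩
        {x | ∑ m, x m = ∑ m : Fin n, ((m.val : ℝ) + 1)} := by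
      apply convexHull_min
      · rintro _ ⟨a, ha, rfl⟩
        exact ⟨blk_vertex lo hi hlt a (hnk' a ha), hT a⟩
      · apply (blk_convex lo hi).inter
        intro x hx z hz c d _ _ hcd
        have hx' : ∑ m, x m = ∑ m : Fin n, ((m.val : ℝ) + 1) := hx
        have hz' : ∑ m, z m = ∑ m : Fin n, ((m.val : ℝ) + 1) := hz
        show ∑ m, (c • x + d • z) m = ∑ m : Fin n, ((m.val : ℝ) + 1)
        rw [combo_eq x z c d hcd, hsumaff, hx', hz']; ring
    obtain ⟨h1, h2⟩ := hsub hpy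
    refine hcomp y (bpi lo hi y) h1 ?_ (hy.trans h2.symm) hj
    intro m hm
    unfold bpi
    rw [if_pos hm]

lemma ble_mul_simple_iff (w' : Perm (Fin n)) (d0 d1 : Fin n) (hd : d0.val + 1 = d1.val)
    (hlt : w' d0 < w' d1) (u : Perm (Fin n)) :
    Ble u (w' * swap d0 d1) ↔ Ble u w' ∨ ∃ a, Ble a w' ∧ u = a * swap d0 d1 := by
  obtain ⟨l, hl, rfl⟩ := exists_red w'
  have h1 := subW_eq _ (hl.snoc_asc d0 d1 hd hlt) u
  rw [wprod_snoc, simpleT_swap d0 d1 hd, mem_subW_snoc, simpleT_swap d0 d1 hd] at h1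
  rw [← h1, subW_eq l hl]
  simp only [subW_eq l hl]

lemma exch {E : Type*} [AddCommGroup E] [Module ℝ E] {H : Set E} (hH : Convex ℝ H) {A B Y : E}
    (hA : A ∈ H) (hB : B ∈ H) (α γ β : ℝ) (h1 : α < β) (h2 : α ≤ γ) (h3 : γ ≤ β)
    (hY : (β - α) • Y = (β - γ) • A + (γ - α) • B) : Y ∈ H := by
  have h0 : 0 < β - α := by linarith
  have : Y = ((β - γ) / (β - α)) • A + ((γ - α) / (β - α)) • B := by
    have e : Y = (β - α)⁻¹ • ((β - α) • Y) := by rw [smul_smul, inv_mul_cancel₀ h0.ne', one_smul]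
    rw [e, hY, smul_add, smul_smul, smul_smul]
    congr 2 <;> field_simp
  rw [this]
  exact hH hA hB (div_nonneg (by linarith) h0.le) (div_nonneg (by linarith) h0.le) (by field_simp; ring)

def segI : Bool → Bool → Prop := fun a b => a = b

lemma sum_two_real {ι : Type*} [Fintype ι] [DecidableEq ι] (f g : ι → ℝ) (a b : ι) (hab : a ≠ b)
    (h : ∀ x, x ≠ a → x ≠ b → f x = g x) (hs : ∑ x, f x = ∑ x, g x) :
    f a + f b = g a + g b := by
  have h1 : ∀ F : ι → ℝ, ∑ x, F x = ∑ x ∈ Finset.univ \ {a, b}, F x + (F a + F b) := by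
    intro F
    rw [← Finset.sum_pair hab, Finset.sum_sdiff (Finset.subset_univ _)]
  have h2 : ∑ x ∈ Finset.univ \ {a, b}, f x = ∑ x ∈ Finset.univ \ {a, b}, g x := by
    apply Finset.sum_congr rfl
    intro x hx
    simp at hx
    exact h x hx.1 hx.2
  rw [h1 f, h1 g, h2] at hs
  linarith

lemma seg_step {ι J : Type} (w' : Perm (Fin n)) (d0 d1 : Fin n) (hd : d0.val + 1 = d1.val)
    {I : ι → J → Prop} (h : Realizes I (bipV w')) (hnk : nk d1.val w' = 0) :
    Realizes (prodI I segI) (bipV (w' * swap d0 d1)) := by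
  have hlt : d0 < d1 := by rw [Fin.lt_def]; omega
  have hw' : w' d0 < w' d1 := by
    have h1 := nk_zero_iff hnk d0
    have h2 := nk_zero_iff hnk d1
    rw [Fin.lt_def]; omega
  have hval : ((d0.val : ℝ) + 1) = d1.val := by exact_mod_cast hd
  refine block_step d0 d1 hlt w' _ h ?_ (fun k : Bool => if k then swap d0 d1 else 1) ?_ ?_ segI
    (fun j y x => if j then x d1 - y d0 else y d0 - x d0) ?_ ?_ ?_ ?_
  · intro k h1 h2
    have : k = d1.val := by omega
    rw [this]; exact hnk
  · intro k m hm
    have n1 : m ≠ d0 := by rintro rfl; rcases hm with h | h; exact lt_irrefl _ h; exact lt_asymm h hlt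
    have n2 : m ≠ d1 := by rintro rfl; rcases hm with h | h; exact lt_asymm h hlt; exact lt_irrefl _ h
    cases k
    · simp
    · simp [swap_apply_of_ne_of_ne n1 n2]
  · intro u
    rw [ble_mul_simple_iff w' d0 d1 hd hw']
    constructor
    · rintro (h | ⟨a, ha, rfl⟩)
      · exact ⟨u, h, false, by simp⟩
      · exact ⟨a, ha, true, by simp⟩
    · rintro ⟨a, ha, k, rfl⟩
      cases k
      · left; simpa using ha
      · right; exact ⟨a, ha, by simp⟩
  · intro j y z x x' t
    cases j <;> simp <;> ring
  · rintro k j x ⟨h1, h2, -⟩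
    cases j <;> cases k <;> simp <;> linarith
  · rintro k j x ⟨h1, h2, -⟩
    cases j <;> cases k <;> simp [segI] <;> intro h <;> linarith
  · rintro y x ⟨h1, h2, -⟩ hout hsum hj
    have hj0 := hj false
    have hj1 := hj true
    simp at hj0 hj1
    have hagree : ∀ m, m ≠ d0 → m ≠ d1 → y m = x m := by
      intro m hm1 hm2
      apply hout
      rw [ne_eq, Fin.ext_iff] at hm1 hm2
      rw [Fin.lt_def, Fin.lt_def]; omega
    have hs := sum_two_real y x d0 d1 hlt.ne hagree hsum
    refine exch (convex_convexHull ℝ _) (subset_convexHull ℝ _ ⟨false, rfl⟩)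
      (subset_convexHull ℝ _ ⟨true, rfl⟩) (x d0) (y d0) (x d1) (by linarith) hj0 hj1 ?_
    funext m
    by_cases hm0 : m = d0
    · subst hm0; simp; ring
    · by_cases hm1 : m = d1
      · subst hm1
        simp
        have : y m = x d0 + x m - y d0 := by linarith
        rw [this]; ring
      · simp [swap_apply_of_ne_of_ne hm0 hm1, hagree m hm0 hm1]; ring

end block


section block4
open Equiv

abbrev K4 := Bool × Bool × Bool × Bool

def sgm {α : Type*} [DecidableEq α] (c0 c1 c2 c3 : α) (e : K4) : Perm α :=
  (if e.1 then swap c1 c2 else 1) * (if e.2.1 then swap c0 c1 else 1) *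
    (if e.2.2.1 then swap c2 c3 else 1) * (if e.2.2.2 then swap c1 c2 else 1)

abbrev sg (e : K4) : Perm (Fin 4) := sgm 0 1 2 3 e

def I34 (e : K4) (j : Fin 10) : Prop :=
  (![sg e 0 = 0, sg e 0 = 2, sg e 3 = 1, sg e 3 = 3, sg e 1 = 0, sg e 2 = 0, sg e 1 = 3, sg e 2 = 3,
    (sg e 0 = 0 ∧ sg e 1 = 1) ∨ (sg e 0 = 1 ∧ sg e 1 = 0),
    (sg e 0 = 0 ∧ sg e 2 = 1) ∨ (sg e 0 = 1 ∧ sg e 2 = 0)] : Fin 10 → Prop) j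

def G4 (j : Fin 10) (Y X : Fin 4 → ℝ) : ℝ :=
  ![Y 0 - X 0, X 2 - Y 0, Y 3 - X 1, X 3 - Y 3, Y 1 - X 0, Y 2 - X 0, X 3 - Y 1, X 3 - Y 2,
    Y 0 + Y 1 - X 0 - X 1, Y 0 + Y 2 - X 0 - X 1] j

lemma G4_aff (j : Fin 10) (y z x x' : Fin 4 → ℝ) (t : ℝ) :
    G4 j (y + t • (z - y)) (x + t • (x' - x)) = G4 j y x + t * (G4 j z x' - G4 j y x) := by
  fin_cases j <;> simp [G4] <;> ring

lemma pair_sum (X : Fin 4 → ℝ) (h0 : X 0 < X 1) (h1 : X 1 < X 2) (h2 : X 2 < X 3) (a b : Fin 4)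
    (hab : a ≠ b) : 0 ≤ X a + X b - X 0 - X 1 ∧
      ((a = 0 ∧ b = 1) ∨ (a = 1 ∧ b = 0) ↔ X a + X b - X 0 - X 1 = 0) := by
  fin_cases a <;> fin_cases b <;> simp at hab ⊢ <;>
    first | (constructor <;> intros <;> linarith) | linarith | skip
  all_goals (constructor; linarith; intro h; linarith)

lemma sg_facts : ∀ e : K4, sg e 0 ≠ 3 ∧ sg e 3 ≠ 0 := by decide

lemma G4_vertex (e : K4) (j : Fin 10) (X : Fin 4 → ℝ) (h0 : X 0 < X 1) (h1 : X 1 < X 2)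
    (h2 : X 2 < X 3) : 0 ≤ G4 j (fun m => X (sg e m)) X ∧
      (I34 e j ↔ G4 j (fun m => X (sg e m)) X = 0) := by
  obtain ⟨f1, f2⟩ := sg_facts e
  have A0 : ∀ a : Fin 4, 0 ≤ X a - X 0 ∧ (a = 0 ↔ X a - X 0 = 0) := by
    intro a
    fin_cases a <;> simp
    all_goals (constructor; linarith; intro h; linarith)
  have A3 : ∀ a : Fin 4, 0 ≤ X 3 - X a ∧ (a = 3 ↔ X 3 - X a = 0) := by
    intro a
    fin_cases a <;> simp
    all_goals (constructor; linarith; intro h; linarith)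
  have A2 : ∀ a : Fin 4, a ≠ 3 → 0 ≤ X 2 - X a ∧ (a = 2 ↔ X 2 - X a = 0) := by
    intro a ha
    fin_cases a <;> simp at ha ⊢
    all_goals (constructor; linarith; intro h; linarith)
  have A1 : ∀ a : Fin 4, a ≠ 0 → 0 ≤ X a - X 1 ∧ (a = 1 ↔ X a - X 1 = 0) := by
    intro a ha
    fin_cases a <;> simp at ha ⊢
    all_goals (constructor; linarith; intro h; linarith)
  have hne : ∀ a b : Fin 4, a ≠ b → sg e a ≠ sg e b := fun a b h => (sg e).injective.ne h
  fin_cases j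
  · exact A0 (sg e 0)
  · exact A2 (sg e 0) f1
  · exact A1 (sg e 3) f2
  · exact A3 (sg e 3)
  · exact A0 (sg e 1)
  · exact A0 (sg e 2)
  · exact A3 (sg e 1)
  · exact A3 (sg e 2)
  · exact pair_sum X h0 h1 h2 _ _ (hne 0 1 (by decide))
  · exact pair_sum X h0 h1 h2 _ _ (hne 0 2 (by decide))

lemma exch4 {H : Set (Fin 4 → ℝ)} (hH : Convex ℝ H) {a b c d a' b' c' d' x y z t : ℝ}
    (hA : ![a, b, c, d] ∈ H) (hB : ![a', b', c', d'] ∈ H) (α γ β : ℝ) (h1 : α < β) (h2 : α ≤ γ)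
    (h3 : γ ≤ β) (e0 : (β - α) * x = (β - γ) * a + (γ - α) * a')
    (e1 : (β - α) * y = (β - γ) * b + (γ - α) * b')
    (e2 : (β - α) * z = (β - γ) * c + (γ - α) * c')
    (e3 : (β - α) * t = (β - γ) * d + (γ - α) * d') : ![x, y, z, t] ∈ H := by
  refine exch hH hA hB α γ β h1 h2 h3 ?_
  funext i
  fin_cases i
  · simpa using e0
  · simpa using e1
  · simpa using e2
  · simpa using e3

lemma pieceA {H : Set (Fin 4 → ℝ)} (hH : Convex ℝ H) {p q r t a d : ℝ} (hpq : p < q)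
    (hrt : r < t) (v1 : ![p, q, r, t] ∈ H) (v2 : ![p, q, t, r] ∈ H) (v3 : ![q, p, r, t] ∈ H)
    (v4 : ![q, p, t, r] ∈ H) (h1 : p ≤ a) (h2 : a ≤ q) (h3 : r ≤ d) (h4 : d ≤ t) :
    ![a, p + q - a, r + t - d, d] ∈ H := by
  have s1 : ![a, p + q - a, r, t] ∈ H := by
    refine exch4 hH v1 v3 p a q hpq h1 h2 ?_ ?_ ?_ ?_ <;> ring
  have s2 : ![a, p + q - a, t, r] ∈ H := by
    refine exch4 hH v2 v4 p a q hpq h1 h2 ?_ ?_ ?_ ?_ <;> ring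
  refine exch4 hH s2 s1 r d t hrt h3 h4 ?_ ?_ ?_ ?_ <;> ring

lemma pieceB {H : Set (Fin 4 → ℝ)} (hH : Convex ℝ H) {p q r t a d : ℝ} (hpq : p < q)
    (hqr : q < r) (v1 : ![p, r, t, q] ∈ H) (v2 : ![p, q, t, r] ∈ H) (v3 : ![r, p, t, q] ∈ H)
    (v4 : ![q, p, t, r] ∈ H) (h1 : p ≤ a) (h2 : a + d ≤ q + r) (h3 : q ≤ d) (h4 : d ≤ r) :
    ![a, p + q + r - a - d, t, d] ∈ H := by
  have s1 : ![p, q + r - d, t, d] ∈ H := by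
    refine exch4 hH v1 v2 q d r hqr h3 h4 ?_ ?_ ?_ ?_ <;> ring
  have s2 : ![q + r - d, p, t, d] ∈ H := by
    refine exch4 hH v3 v4 q d r hqr h3 h4 ?_ ?_ ?_ ?_ <;> ring
  refine exch4 hH s1 s2 p a (q + r - d) (by linarith) h1 (by linarith) ?_ ?_ ?_ ?_ <;> ring

lemma pieceC {H : Set (Fin 4 → ℝ)} (hH : Convex ℝ H) {p q r t a d : ℝ}
    (hqr : q < r) (hrt : r < t) (v1 : ![q, p, t, r] ∈ H) (v2 : ![r, p, t, q] ∈ H)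
    (v3 : ![q, p, r, t] ∈ H) (v4 : ![r, p, q, t] ∈ H) (h1 : q ≤ a) (h2 : a ≤ r)
    (h3 : q + r ≤ a + d) (h4 : d ≤ t) :
    ![a, p, q + r + t - a - d, d] ∈ H := by
  have s1 : ![a, p, t, q + r - a] ∈ H := by
    refine exch4 hH v1 v2 q a r hqr h1 h2 ?_ ?_ ?_ ?_ <;> ring
  have s2 : ![a, p, q + r - a, t] ∈ H := by
    refine exch4 hH v3 v4 q a r hqr h1 h2 ?_ ?_ ?_ ?_ <;> ring
  refine exch4 hH s1 s2 (q + r - a) d t (by linarith) (by linarith) h4 ?_ ?_ ?_ ?_ <;> ring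

lemma mid_swap_convex {H : Set (Fin 4 → ℝ)} (hH : Convex ℝ H) :
    Convex ℝ {Z : Fin 4 → ℝ | ![Z 0, Z 2, Z 1, Z 3] ∈ H} := by
  intro x hx y hy a b ha hb hab
  have := hH hx hy ha hb hab
  show ![_, _, _, _] ∈ H
  convert this using 1
  funext i
  fin_cases i <;> simp

lemma comp4 {H : Set (Fin 4 → ℝ)} (hH : Convex ℝ H) {p q r t a b c d : ℝ} (hpq : p < q)
    (hqr : q < r) (hrt : r < t)
    (hv : ∀ e : K4, (fun m => ![p, q, r, t] (sg e m)) ∈ H)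
    (hs : a + b + c + d = p + q + r + t)
    (g0 : p ≤ a) (g1 : a ≤ r) (g2 : q ≤ d) (g3 : d ≤ t) (g4 : p ≤ b) (g5 : p ≤ c) (g6 : b ≤ t)
    (g7 : c ≤ t) (g8 : p + q ≤ a + b) (g9 : p + q ≤ a + c) : ![a, b, c, d] ∈ H := by
  have gen : ∀ (e : K4) (x y z u : ℝ), x = ![p, q, r, t] (sg e 0) → y = ![p, q, r, t] (sg e 1) →
      z = ![p, q, r, t] (sg e 2) → u = ![p, q, r, t] (sg e 3) → ![x, y, z, u] ∈ H := by
    intro e x y z u hx hy hz hu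
    convert hv e using 1
    funext i
    fin_cases i
    · exact hx
    · exact hy
    · exact hz
    · exact hu
  have pqrt : ![p, q, r, t] ∈ H := gen (false, false, false, false) _ _ _ _ rfl rfl rfl rfl
  have pqtr : ![p, q, t, r] ∈ H := gen (false, false, true, false) _ _ _ _ rfl rfl rfl rfl
  have qprt : ![q, p, r, t] ∈ H := gen (false, true, false, false) _ _ _ _ rfl rfl rfl rfl
  have qptr : ![q, p, t, r] ∈ H := gen (false, true, true, false) _ _ _ _ rfl rfl rfl rfl
  have prqt : ![p, r, q, t] ∈ H := gen (false, false, false, true) _ _ _ _ rfl rfl rfl rfl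
  have ptqr : ![p, t, q, r] ∈ H := gen (false, false, true, true) _ _ _ _ rfl rfl rfl rfl
  have qrpt : ![q, r, p, t] ∈ H := gen (false, true, false, true) _ _ _ _ rfl rfl rfl rfl
  have qtpr : ![q, t, p, r] ∈ H := gen (false, true, true, true) _ _ _ _ rfl rfl rfl rfl
  have prtq : ![p, r, t, q] ∈ H := gen (true, false, true, false) _ _ _ _ rfl rfl rfl rfl
  have rptq : ![r, p, t, q] ∈ H := gen (true, true, true, false) _ _ _ _ rfl rfl rfl rfl
  have ptrq : ![p, t, r, q] ∈ H := gen (true, false, true, true) _ _ _ _ rfl rfl rfl rfl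
  have rtpq : ![r, t, p, q] ∈ H := gen (true, true, true, true) _ _ _ _ rfl rfl rfl rfl
  have rpqt : ![r, p, q, t] ∈ H := gen (true, true, false, false) _ _ _ _ rfl rfl rfl rfl
  have rqpt : ![r, q, p, t] ∈ H := gen (true, true, false, true) _ _ _ _ rfl rfl rfl rfl
  have hH' := mid_swap_convex hH
  have mid : ∀ x y z u : ℝ, ![x, z, y, u] ∈ H → ![x, y, z, u] ∈
      {Z : Fin 4 → ℝ | ![Z 0, Z 2, Z 1, Z 3] ∈ H} := fun x y z u h => h
  have final : ∀ lo hi : ℝ, lo < hi → ![a, lo, hi, d] ∈ H → ![a, hi, lo, d] ∈ H → lo ≤ b → b ≤ hi →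
      lo + hi = b + c → ![a, b, c, d] ∈ H := by
    intro lo hi h1 h2 h3 h4 h5 h6
    have hc : c = lo + hi - b := by linarith
    subst hc
    refine exch4 hH h2 h3 lo b hi h1 h4 h5 ?_ ?_ ?_ ?_ <;> ring
  by_cases hA : a ≤ q ∧ r ≤ d
  · have s1 := pieceA hH hpq hrt pqrt pqtr qprt qptr g0 hA.1 hA.2 g3
    have s2 := pieceA hH' hpq hrt (mid _ _ _ _ prqt) (mid _ _ _ _ ptqr) (mid _ _ _ _ qrpt)
      (mid _ _ _ _ qtpr) g0 hA.1 hA.2 g3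
    exact final _ _ (by linarith) s1 s2 (by linarith) (by linarith) (by linarith)
  · by_cases hB : a + d ≤ q + r
    · have hd : d ≤ r := by
        by_contra hcon
        exact hA ⟨by linarith, by linarith⟩
      have s1 := pieceB hH hpq hqr prtq pqtr rptq qptr g0 hB g2 hd
      have s2 := pieceB hH' hpq hqr (mid _ _ _ _ ptrq) (mid _ _ _ _ ptqr) (mid _ _ _ _ rtpq)
        (mid _ _ _ _ qtpr) g0 hB g2 hd
      exact final _ _ (by linarith) s1 s2 (by linarith) (by linarith) (by linarith)
    · have ha : q ≤ a := by
        by_contra hcon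
        exact hA ⟨by linarith, by linarith⟩
      have s1 := pieceC hH hqr hrt qptr rptq qprt rpqt ha g1 (by linarith) g3
      have s2 := pieceC hH' hqr hrt (mid _ _ _ _ qtpr) (mid _ _ _ _ rtpq) (mid _ _ _ _ qrpt)
        (mid _ _ _ _ rqpt) ha g1 (by linarith) g3
      exact final _ _ (by linarith) s1 s2 (by linarith) (by linarith) (by linarith)

end block4


section quad
open Equiv

variable {n : ℕ}

lemma ble_step (w' : Perm (Fin n)) (d0 d1 : Fin n) (hd : d0.val + 1 = d1.val)
    (hlt : w' d0 < w' d1) (u : Perm (Fin n)) :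
    Ble u (w' * swap d0 d1) ↔ ∃ a, Ble a w' ∧ ∃ e : Bool, u = a * (if e then swap d0 d1 else 1) := by
  rw [ble_mul_simple_iff w' d0 d1 hd hlt]
  constructor
  · rintro (h | ⟨a, ha, rfl⟩)
    · exact ⟨u, h, false, by simp⟩
    · exact ⟨a, ha, true, by simp⟩
  · rintro ⟨a, ha, e, rfl⟩
    cases e
    · left; simpa using ha
    · right; exact ⟨a, ha, by simp⟩

lemma sgm_map {α β : Type*} [DecidableEq α] [DecidableEq β] (c : α → β) (hc : Function.Injective c)
    (a0 a1 a2 a3 : α) (e : K4) (i : α) :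
    sgm (c a0) (c a1) (c a2) (c a3) e (c i) = c (sgm a0 a1 a2 a3 e i) := by
  have key : ∀ (b : Bool) (x y z : α), (if b then swap (c x) (c y) else 1) (c z) =
      c ((if b then swap x y else 1) z) := by
    intro b x y z
    cases b
    · simp
    · simp [hc.swap_apply]
  simp only [sgm, Perm.mul_apply, key]

lemma sgm_out {α : Type*} [DecidableEq α] (a0 a1 a2 a3 : α) (e : K4) (m : α) (h0 : m ≠ a0)
    (h1 : m ≠ a1) (h2 : m ≠ a2) (h3 : m ≠ a3) : sgm a0 a1 a2 a3 e m = m := by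
  have key : ∀ (b : Bool) (x y : α), m ≠ x → m ≠ y → (if b then swap x y else 1) m = m := by
    intro b x y hx hy
    cases b
    · simp
    · simp [swap_apply_of_ne_of_ne hx hy]
  simp only [sgm, Perm.mul_apply, key _ _ _ h1 h2, key _ _ _ h2 h3, key _ _ _ h0 h1]

lemma quad_step {ι J : Type} (w' : Perm (Fin n)) (c : Fin 4 → Fin n) (base : ℕ)
    (hc : ∀ i, (c i).val = base + i.val) {I : ι → J → Prop} (h : Realizes I (bipV w'))
    (hnk : ∀ k, base < k → k ≤ base + 3 → nk k w' = 0) :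
    Realizes (prodI I I34)
      (bipV (w' * swap (c 1) (c 2) * swap (c 0) (c 1) * swap (c 2) (c 3) * swap (c 1) (c 2))) := by
  have c0 := hc 0
  have c1 := hc 1
  have c2 := hc 2
  have c3 := hc 3
  simp at c0 c1 c2 c3
  have hinj : Function.Injective c := by
    intro i j hij
    have := congrArg Fin.val hij
    rw [hc, hc] at this
    exact Fin.ext (by omega)
  have o1 : w' (c 0) < w' (c 1) := by
    have h1 := nk_zero_iff (hnk (base + 1) (by omega) (by omega)) (c 0)
    have h2 := nk_zero_iff (hnk (base + 1) (by omega) (by omega)) (c 1)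
    rw [Fin.lt_def]; omega
  have o2 : w' (c 1) < w' (c 2) := by
    have h1 := nk_zero_iff (hnk (base + 2) (by omega) (by omega)) (c 1)
    have h2 := nk_zero_iff (hnk (base + 2) (by omega) (by omega)) (c 2)
    rw [Fin.lt_def]; omega
  have o3 : w' (c 2) < w' (c 3) := by
    have h1 := nk_zero_iff (hnk (base + 3) (by omega) (by omega)) (c 2)
    have h2 := nk_zero_iff (hnk (base + 3) (by omega) (by omega)) (c 3)
    rw [Fin.lt_def]; omega
  have ne : ∀ i j : Fin 4, i ≠ j → c i ≠ c j := fun i j hij => hinj.ne hij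
  have n01 := ne 0 1 (by decide)
  have n02 := ne 0 2 (by decide)
  have n03 := ne 0 3 (by decide)
  have n12 := ne 1 2 (by decide)
  have n13 := ne 1 3 (by decide)
  have n23 := ne 2 3 (by decide)
  have hord : ∀ x, Blk (c 0) (c 3) x → x (c 0) < x (c 1) ∧ x (c 1) < x (c 2) ∧ x (c 2) < x (c 3) := by
    rintro x ⟨h1, h2, h3⟩
    have e1 := h3 (c 1) (by rw [Fin.lt_def]; omega) (by rw [Fin.lt_def]; omega)
    have e2 := h3 (c 2) (by rw [Fin.lt_def]; omega) (by rw [Fin.lt_def]; omega)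
    rw [c0] at h1
    rw [c1] at e1
    rw [c2] at e2
    rw [c3] at h2
    push_cast at *
    refine ⟨?_, ?_, ?_⟩ <;> linarith
  have hmap : ∀ (e : K4) (x : Fin n → ℝ), (fun i => x (sgm (c 0) (c 1) (c 2) (c 3) e (c i))) =
      fun i => (fun i => x (c i)) (sg e i) := by
    intro e x
    funext i
    rw [sgm_map c hinj]
  refine block_step (c 0) (c 3) (by rw [Fin.lt_def]; omega) w' _ h ?_
    (fun e : K4 => sgm (c 0) (c 1) (c 2) (c 3) e) ?_ ?_ I34
    (fun j y x => G4 j (fun i => y (c i)) (fun i => x (c i))) ?_ ?_ ?_ ?_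
  · intro k h1 h2
    exact hnk k (by omega) (by omega)
  · intro e m hm
    rw [Fin.lt_def, Fin.lt_def] at hm
    apply sgm_out <;> rw [ne_eq, Fin.ext_iff] <;> omega
  · intro u
    rw [ble_step _ (c 1) (c 2) (by omega)]
    swap
    · simp only [Perm.mul_apply]
      rw [swap_apply_of_ne_of_ne n12 n13, swap_apply_right, swap_apply_of_ne_of_ne n01 n02,
        swap_apply_left, swap_apply_of_ne_of_ne n03.symm n13.symm,
        swap_apply_of_ne_of_ne n13.symm n23.symm]
      exact o1.trans (o2.trans o3)
    simp only [ble_step (w' * swap (c 1) (c 2) * swap (c 0) (c 1)) (c 2) (c 3) (by omega) (by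
      simp only [Perm.mul_apply]
      rw [swap_apply_of_ne_of_ne n02.symm n12.symm, swap_apply_right,
        swap_apply_of_ne_of_ne n03.symm n13.symm,
        swap_apply_of_ne_of_ne n13.symm n23.symm]
      exact (o2.trans o3)),
      ble_step (w' * swap (c 1) (c 2)) (c 0) (c 1) (by omega) (by
      simp only [Perm.mul_apply]
      rw [swap_apply_of_ne_of_ne n01 n02, swap_apply_left]
      exact (o1.trans o2)),
      ble_step w' (c 1) (c 2) (by omega) o2]
    constructor
    · rintro ⟨_, ⟨_, ⟨_, ⟨a, ha, e1, rfl⟩, e2, rfl⟩, e3, rfl⟩, e4, rfl⟩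
      exact ⟨a, ha, (e1, e2, e3, e4), by simp only [sgm, mul_assoc]⟩
    · rintro ⟨a, ha, ⟨e1, e2, e3, e4⟩, rfl⟩
      exact ⟨_, ⟨_, ⟨_, ⟨a, ha, e1, rfl⟩, e2, rfl⟩, e3, rfl⟩, e4, by simp only [sgm, mul_assoc]⟩
  · intro j y z x x' t
    exact G4_aff j _ _ _ _ t
  · intro e j x hx
    obtain ⟨h1, h2, h3⟩ := hord x hx
    have := (G4_vertex e j (fun i => x (c i)) h1 h2 h3).1
    rw [← hmap] at this
    exact this
  · intro e j x hx
    obtain ⟨h1, h2, h3⟩ := hord x hx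
    have := (G4_vertex e j (fun i => x (c i)) h1 h2 h3).2
    rw [← hmap] at this
    exact this
  · intro y x hx hout hsum hj
    obtain ⟨h1, h2, h3⟩ := hord x hx
    have hout' : ∀ m, m ≠ c 0 → m ≠ c 1 → m ≠ c 2 → m ≠ c 3 → y m = x m := by
      intro m q0 q1 q2 q3
      apply hout
      rw [ne_eq, Fin.ext_iff] at q0 q1 q2 q3
      rw [Fin.lt_def, Fin.lt_def]; omega
    have hs : ∑ i, (y (c i) - x (c i)) = ∑ m, (y m - x m) := by
      apply Fintype.sum_of_injective c hinj
      · intro m hm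
        rw [hout' m, sub_self] <;> rintro rfl <;> exact hm ⟨_, rfl⟩
      · intro i; rfl
    rw [Finset.sum_sub_distrib, Finset.sum_sub_distrib, hsum, sub_self, Fin.sum_univ_four,
      Fin.sum_univ_four] at hs
    let Ψ : (Fin 4 → ℝ) → Fin n → ℝ := fun Z m => if m = c 0 then Z 0 else if m = c 1 then Z 1 else
      if m = c 2 then Z 2 else if m = c 3 then Z 3 else x m
    have hΨ : ∀ Z (z : Fin n → ℝ), (∀ i, z (c i) = Z i) →
        (∀ m, m ≠ c 0 → m ≠ c 1 → m ≠ c 2 → m ≠ c 3 → z m = x m) → Ψ Z = z := by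
      intro Z z hz1 hz2
      funext m
      simp only [Ψ]
      split_ifs with q0 q1 q2 q3
      · rw [q0, hz1]
      · rw [q1, hz1]
      · rw [q2, hz1]
      · rw [q3, hz1]
      · rw [hz2 m q0 q1 q2 q3]
    set HH : Set (Fin n → ℝ) := convexHull ℝ
        (Set.range fun e : K4 => (fun m => x (sgm (c 0) (c 1) (c 2) (c 3) e m))) with hHH
    have hHc : Convex ℝ HH := convex_convexHull ℝ _
    have hconv : Convex ℝ {Z | Ψ Z ∈ HH} := by
      intro A hA B hB s t hs0 ht0 hst
      have hA' : Ψ A ∈ HH := hA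
      have hB' : Ψ B ∈ HH := hB
      have := hHc hA' hB' hs0 ht0 hst
      show Ψ (s • A + t • B) ∈ HH
      convert this using 1
      funext m
      simp only [Ψ, Pi.add_apply, Pi.smul_apply, smul_eq_mul]
      split_ifs <;> try rfl
      rw [← add_mul, hst, one_mul]
    have e4 : ∀ f : Fin n → ℝ, (![f (c 0), f (c 1), f (c 2), f (c 3)] : Fin 4 → ℝ) =
        fun i => f (c i) := by
      intro f
      funext i
      fin_cases i <;> rfl
    have q0 := hj 0
    have q1 := hj 1
    have q2 := hj 2
    have q3 := hj 3
    have q4 := hj 4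
    have q5 := hj 5
    have q6 := hj 6
    have q7 := hj 7
    have q8 := hj 8
    have q9 := hj 9
    simp [G4] at q0 q1 q2 q3 q4 q5 q6 q7 q8 q9
    have fin := comp4 hconv (p := x (c 0)) (q := x (c 1)) (r := x (c 2)) (t := x (c 3))
      (a := y (c 0)) (b := y (c 1)) (c := y (c 2)) (d := y (c 3)) h1 h2 h3 ?_ (by linarith)
      q0 q1 q2 q3 q4 q5 q6 q7 (by linarith) (by linarith)
    · rw [e4] at fin
      have fin' : Ψ (fun i => y (c i)) ∈ HH := fin
      rw [hΨ _ y (fun i => rfl) hout'] at fin'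
      exact fin'
    · intro e
      rw [e4, ← hmap]
      show Ψ (fun i => x (sgm (c 0) (c 1) (c 2) (c 3) e (c i))) ∈ HH
      rw [hΨ _ (fun m => x (sgm (c 0) (c 1) (c 2) (c 3) e m)) (fun i => rfl)]
      · exact subset_convexHull ℝ _ ⟨e, rfl⟩
      · intro m r0 r1 r2 r3
        rw [sgm_out _ _ _ _ e m r0 r1 r2 r3]

end quad


section realize
open Equiv

variable {n : ℕ}

lemma ble_one_iff (u : Perm (Fin n)) : Ble u 1 ↔ u = 1 := by
  have := subW_eq (n := n) [] (by simp [Red, wprod, invN_one]) u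
  rw [show wprod n [] = 1 by simp [wprod]] at this
  rw [← this]
  constructor
  · rintro ⟨l', hl, rfl⟩
    rw [List.sublist_nil] at hl
    subst hl; simp [wprod]
  · rintro rfl
    exact ⟨[], List.Sublist.refl _, by simp [wprod]⟩

lemma realizes_one : Realizes (cubeI 0) (bipV (1 : Perm (Fin n))) := by
  have hV : bipV (1 : Perm (Fin n)) = {permPoint n 1} := by
    ext x
    simp [bipV, ble_one_iff]
  rw [hV]
  refine ⟨fun _ => permPoint n 1, {permPoint n 1}, fun j => j.1.elim0, ?_, ?_, ?_, ?_, ?_, ?_, ?_⟩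
  · simp [Set.range_const]
  · rintro y rfl z hz t
    rw [Set.mem_singleton_iff] at hz
    subst hz; simp
  · intro i; rfl
  · intro j; exact j.1.elim0
  · intro i j; exact j.1.elim0
  · intro i j; exact j.1.elim0
  · intro y hy _
    exact subset_convexHull ℝ _ hy

lemma Realizes.absorb {E : Type*} [AddCommGroup E] [Module ℝ E] {ι J : Type} {K : ι → J → Prop}
    {m : ℕ} {V : Set E} (h : Realizes (prodI (prodI (cubeI m) K) segI) V) :
    Realizes (prodI (cubeI (m + 1)) K) V := by
  refine h.reindex _ (fun p => ((fun i => p.1 i.succ, p.2), p.1 0)) ?_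
    (fun q => match q with
      | Sum.inl (j, b) => Fin.cases (motive := fun _ => ((Fin m × Bool) ⊕ J) ⊕ Bool)
          (Sum.inr b) (fun i => Sum.inl (Sum.inl (i, b))) j
      | Sum.inr j => Sum.inl (Sum.inr j)) ?_ ?_
  · rintro ⟨⟨s, k⟩, b⟩
    refine ⟨(Fin.cons b s, k), ?_⟩
    simp
  · rintro ((⟨i, b⟩ | j) | b)
    · exact ⟨Sum.inl (i.succ, b), by simp⟩
    · exact ⟨Sum.inr j, rfl⟩
    · exact ⟨Sum.inl (0, b), by simp⟩
  · rintro ⟨s, k⟩ (⟨j, b⟩ | j)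
    · refine Fin.cases ?_ (fun i => ?_) j
      · simp [prodI, cubeI, segI]
      · simp [prodI, cubeI, segI]
    · simp [prodI]

lemma Realizes.absorb0 {E : Type*} [AddCommGroup E] [Module ℝ E]
    {m : ℕ} {V : Set E} (h : Realizes (prodI (cubeI m) segI) V) :
    Realizes (cubeI (m + 1)) V := by
  refine h.reindex _ (fun p => ((fun i => p i.succ), p 0)) ?_
    (fun q => Fin.cases (motive := fun _ => (Fin m × Bool) ⊕ Bool)
          (Sum.inr q.2) (fun i => (Sum.inl (i, q.2))) q.1) ?_ ?_
  · rintro ⟨s, b⟩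
    refine ⟨Fin.cons b s, ?_⟩
    simp
  · rintro (⟨i, b⟩ | b)
    · exact ⟨(i.succ, b), by simp⟩
    · exact ⟨(0, b), by simp⟩
  · rintro s ⟨j, b⟩
    refine Fin.cases ?_ (fun i => ?_) j
    · simp [prodI, cubeI, segI]
    · simp [prodI, cubeI, segI]

lemma realizes_R1 : ∀ (N : ℕ) (w : Perm (Fin n)), invN w = N → Av321 w → (∀ k, nk k w ≤ 1) →
    Realizes (cubeI N) (bipV w) := by
  intro N
  induction N with
  | zero =>
    intro w hN _ _
    have : w = 1 := by
      by_contra hw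
      obtain ⟨d0, d1, h, hd⟩ := exists_descent w hw
      have := invN_desc w d0 d1 h hd
      omega
    subst this
    exact realizes_one
  | succ N ih =>
    intro w hN hav hk
    have hw : w ≠ 1 := by
      rintro rfl
      rw [invN_one] at hN; omega
    obtain ⟨d0, d1, h, hd⟩ := exists_descent w hw
    have hinv := invN_desc w d0 d1 h hd
    obtain ⟨p1, p2, p3⟩ := av_peel w hav d0 d1 h hd
    have hk' : ∀ k, nk k (w * swap d0 d1) ≤ 1 := by
      intro k
      by_cases hkd : k = d1.val
      · subst hkd; have := hk d1.val; omega
      · rw [p3 k hkd]; exact hk k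
    have := seg_step (w * swap d0 d1) d0 d1 h (ih _ (by omega) p1 hk')
      (by have := hk d1.val; omega)
    rw [mul_assoc, swap_mul_self, mul_one] at this
    exact this.absorb0

lemma mono_range (w : Perm (Fin n)) (lo hi : ℕ)
    (h : ∀ d0 d1 : Fin n, d0.val + 1 = d1.val → lo ≤ d0.val → d1.val < hi → w d0 < w d1) :
    ∀ (t : ℕ) (a b : Fin n), lo ≤ a.val → b.val < hi → b.val = a.val + t → w a ≤ w b := by
  intro t
  induction t with
  | zero =>
    intro a b _ _ hab
    have : a = b := by ext; omega
    rw [this]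
  | succ t ih =>
    intro a b ha hb hab
    have hn := b.isLt
    have h1 := ih a ⟨a.val + t, by omega⟩ ha (by simp; omega) rfl
    exact h1.trans (h ⟨a.val + t, by omega⟩ b (by simp; omega) (by simp; omega) hb).le

lemma realizes_R2 : ∀ (N : ℕ) (w : Perm (Fin n)) (i : ℕ), invN w = N → Cl w i →
    ∃ m, N = m + 4 ∧ Realizes (prodI (cubeI m) I34) (bipV w) := by
  intro N
  induction N with
  | zero =>
    intro w i hN hcl
    exfalso
    have : w = 1 := by
      by_contra hw
      obtain ⟨d0, d1, h, hd⟩ := exists_descent w hw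
      have := invN_desc w d0 d1 h hd
      omega
    subst this
    have := hcl.2.1
    rw [nk_one] at this
    omega
  | succ N ih =>
    intro w i hN hcl
    obtain ⟨hav, h2, hk⟩ := hcl
    by_cases hex : ∃ d0 d1 : Fin n, d0.val + 1 = d1.val ∧ w d1 < w d0 ∧ d1.val ≠ i
    · obtain ⟨d0, d1, h, hd, hdi⟩ := hex
      have hinv := invN_desc w d0 d1 h hd
      obtain ⟨p1, p2, p3⟩ := av_peel w hav d0 d1 h hd
      have hk' : ∀ k ≠ i, nk k (w * swap d0 d1) ≤ 1 := by
        intro k hki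
        by_cases hkd : k = d1.val
        · subst hkd; have := hk _ hki; omega
        · rw [p3 k hkd]; exact hk k hki
      obtain ⟨m, hm, hr⟩ := ih (w * swap d0 d1) i (by omega)
        ⟨p1, by rw [p3 i (Ne.symm hdi)]; exact h2, hk'⟩
      have := seg_step (w * swap d0 d1) d0 d1 h hr (by have := hk d1.val hdi; omega)
      rw [mul_assoc, swap_mul_self, mul_one] at this
      exact ⟨m + 1, by omega, this.absorb⟩
    · push Not at hex
      have hasc : ∀ d0 d1 : Fin n, d0.val + 1 = d1.val → d1.val ≠ i → w d0 < w d1 := by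
        intro d0 d1 h hne
        by_contra hcon
        have hne' : w d1 ≠ w d0 := fun h' => by
          have := w.injective h'
          rw [this] at h; omega
        exact hne (hex d0 d1 h (lt_of_le_of_ne (not_lt.1 hcon) hne'))
      have mL := mono_range w 0 i (fun d0 d1 h _ h' => hasc d0 d1 h (by omega))
      have mR := mono_range w i n (fun d0 d1 h h' _ => hasc d0 d1 h (by omega))
      obtain ⟨a, ha, b, hb, hab⟩ := two_le_of_lt (s := Lk i w)
        (by show 1 < nk i w; omega)
      obtain ⟨a', ha', b', hb', hab'⟩ := two_le_of_lt (s := Rk i w)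
        (by rw [card_Rk]; omega)
      rw [mem_Lk] at ha hb
      rw [mem_Rk] at ha' hb'
      rw [Fin.lt_def] at hab hab'
      have hb'n := b'.isLt
      have hc : ∀ t : Fin 4, (i - 2) + t.val < n := fun t => by have := t.isLt; omega
      let c : Fin 4 → Fin n := fun t => ⟨(i - 2) + t.val, hc t⟩
      have c0 : (c 0).val = i - 2 := rfl
      have c1 : (c 1).val = i - 1 := by simp [c]; omega
      have c2 : (c 2).val = i := by simp [c]; omega
      have c3 : (c 3).val = i + 1 := by simp [c]; omega
      have v0 : i ≤ (w (c 0)).val := by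
        have := mL ((c 0).val - a.val) a (c 0) (by omega) (by omega) (by omega)
        rw [Fin.le_def] at this; omega
      have v1 : i ≤ (w (c 1)).val := by
        have := mL ((c 1).val - b.val) b (c 1) (by omega) (by omega) (by omega)
        rw [Fin.le_def] at this; omega
      have v2 : (w (c 2)).val < i := by
        have := mR (a'.val - (c 2).val) (c 2) a' (by omega) (by omega) (by omega)
        rw [Fin.le_def] at this; omega
      have v3 : (w (c 3)).val < i := by
        have := mR (b'.val - (c 3).val) (c 3) b' (by omega) (by omega) (by omega)
        rw [Fin.le_def] at this; omega
      have n01 : c 0 ≠ c 1 := by rw [Ne, Fin.ext_iff]; omega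
      have n02 : c 0 ≠ c 2 := by rw [Ne, Fin.ext_iff]; omega
      have n03 : c 0 ≠ c 3 := by rw [Ne, Fin.ext_iff]; omega
      have n12 : c 1 ≠ c 2 := by rw [Ne, Fin.ext_iff]; omega
      have n13 : c 1 ≠ c 3 := by rw [Ne, Fin.ext_iff]; omega
      have n23 : c 2 ≠ c 3 := by rw [Ne, Fin.ext_iff]; omega
      have e12 : (c 1).val + 1 = (c 2).val := by omega
      have e01 : (c 0).val + 1 = (c 1).val := by omega
      have e23 : (c 2).val + 1 = (c 3).val := by omega
      clear_value c
      have q1 : w (c 2) < w (c 1) := by rw [Fin.lt_def]; omega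
      have q2 : (w * swap (c 1) (c 2)) (c 3) < (w * swap (c 1) (c 2)) (c 2) := by
        rw [Perm.mul_apply, Perm.mul_apply, swap_apply_right, swap_apply_of_ne_of_ne n13.symm n23.symm,
          Fin.lt_def]
        omega
      have q3 : (w * swap (c 1) (c 2) * swap (c 2) (c 3)) (c 1) <
          (w * swap (c 1) (c 2) * swap (c 2) (c 3)) (c 0) := by
        simp only [Perm.mul_apply]
        rw [swap_apply_of_ne_of_ne n12 n13, swap_apply_left, swap_apply_of_ne_of_ne n02 n03,
          swap_apply_of_ne_of_ne n01 n02, Fin.lt_def]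
        omega
      have q4 : (w * swap (c 1) (c 2) * swap (c 2) (c 3) * swap (c 0) (c 1)) (c 2) <
          (w * swap (c 1) (c 2) * swap (c 2) (c 3) * swap (c 0) (c 1)) (c 1) := by
        simp only [Perm.mul_apply]
        rw [swap_apply_right, swap_apply_of_ne_of_ne n02 n03, swap_apply_of_ne_of_ne n01 n02,
          swap_apply_of_ne_of_ne n02.symm n12.symm, swap_apply_left,
          swap_apply_of_ne_of_ne n13.symm n23.symm, Fin.lt_def]
        omega
      obtain ⟨a1, b1, f1⟩ := av_peel _ hav _ _ e12 q1
      obtain ⟨a2, b2, f2⟩ := av_peel _ a1 _ _ e23 q2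
      obtain ⟨a3, b3, f3⟩ := av_peel _ a2 _ _ e01 q3
      obtain ⟨a4, b4, f4⟩ := av_peel _ a3 _ _ e12 q4
      have i1 := invN_desc _ _ _ e12 q1
      have i2 := invN_desc _ _ _ e23 q2
      have i3 := invN_desc _ _ _ e01 q3
      have i4 := invN_desc _ _ _ e12 q4
      have hw : w = w * swap (c 1) (c 2) * swap (c 2) (c 3) * swap (c 0) (c 1) * swap (c 1) (c 2) *
          swap (c 1) (c 2) * swap (c 0) (c 1) * swap (c 2) (c 3) * swap (c 1) (c 2) := by
        simp [mul_assoc]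
      set w1 := w * swap (c 1) (c 2)
      set w2 := w1 * swap (c 2) (c 3)
      set w3 := w2 * swap (c 0) (c 1)
      set w4 := w3 * swap (c 1) (c 2)
      have z2 : nk (c 2).val w4 = 0 := by
        have := f3 (c 2).val (by omega)
        have := f2 (c 2).val (by omega)
        rw [← c2] at h2
        omega
      have z3 : nk (c 3).val w4 = 0 := by
        have := f4 (c 3).val (by omega)
        have := f3 (c 3).val (by omega)
        have := f1 (c 3).val (by omega)
        have := hk (c 3).val (by omega)
        omega
      have z1 : nk (c 1).val w4 = 0 := by
        have := f4 (c 1).val (by omega)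
        have := f2 (c 1).val (by omega)
        have := f1 (c 1).val (by omega)
        have := hk (c 1).val (by omega)
        omega
      have hk4 : ∀ k, nk k w4 ≤ 1 := by
        intro k
        by_cases k1 : k = (c 1).val
        · subst k1; omega
        by_cases k2 : k = (c 2).val
        · subst k2; omega
        by_cases k3 : k = (c 3).val
        · subst k3; omega
        rw [f4 k k2, f3 k k1, f2 k k3, f1 k k2]
        exact hk k (by omega)
      have hr := quad_step w4 c (i - 2) (by
          intro t
          fin_cases t
          · show (c 0).val = i - 2 + 0; omega
          · show (c 1).val = i - 2 + 1; omega
          · show (c 2).val = i - 2 + 2; omega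
          · show (c 3).val = i - 2 + 3; omega) (realizes_R1 _ w4 rfl a4 hk4) (by
          intro k hk1 hk2
          have : k = (c 1).val ∨ k = (c 2).val ∨ k = (c 3).val := by omega
          rcases this with rfl | rfl | rfl <;> assumption)
      rw [← hw] at hr
      exact ⟨invN w4, by omega, hr⟩

lemma cl3412 : Cl pattern3412 2 := by
  refine ⟨by unfold Av321; decide, by decide, ?_⟩
  intro k hk
  have h4 : k < 4 ∨ 4 ≤ k := by omega
  rcases h4 with h | h
  · interval_cases k <;> revert hk <;> decide
  · have : Lk k pattern3412 = ∅ := by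
      ext x
      rw [mem_Lk]
      have := (pattern3412 x).isLt
      simp; omega
    simp [nk, this]

lemma inv3412 : invN pattern3412 = 4 := by decide

lemma backward (n : ℕ) (w : Equiv.Perm (Fin n))
    (h : ContainsPatternOnce w pattern3412 ∧ AvoidsPattern w pattern321) :
    CombEquiv (BIP n 1 w)
        (BIP 4 1 pattern3412 ×ˢ
          {x : Fin (permLen n w - 4) → ℝ | ∀ k, x k ∈ Set.Icc (0 : ℝ) 1}) := by
  obtain ⟨i, hi⟩ := (pattern_iff w).1 h
  obtain ⟨m, hm, hr⟩ := realizes_R2 _ w i rfl hi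
  obtain ⟨m', hm', hr'⟩ := realizes_R2 _ pattern3412 2 inv3412 cl3412
  have : m' = 0 := by omega
  subst this
  rw [permLen_eq, show invN w - 4 = m by omega, BIP_eq, BIP_eq, ← hull_cubeV, ← convexHull_prod]
  refine realizes_combEquiv hr ?_
  refine (hr'.prod (realizes_cube m)).reindex _ (fun p => ((Fin.elim0, p.2), p.1)) ?_
    (fun q => match q with
      | Sum.inl j => Sum.inr j
      | Sum.inr j => Sum.inl (Sum.inr j)) ?_ ?_
  · rintro ⟨⟨s, k⟩, t⟩
    refine ⟨(t, k), ?_⟩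
    have : s = Fin.elim0 := Subsingleton.elim _ _
    rw [this]
  · rintro ((⟨j, _⟩ | j) | j)
    · exact j.elim0
    · exact ⟨Sum.inr j, rfl⟩
    · exact ⟨Sum.inl j, rfl⟩
  · rintro ⟨s, k⟩ (j | j)
    · simp [prodI]
    · simp [prodI]

end realize


section extreme
open Equiv

variable {n : ℕ}

lemma sq_id (a b : ℝ) (hab : a + b = 1) (x y : Fin n → ℝ) :
    ∑ i, (a • x + b • y) i ^ 2 + a * b * ∑ i, (x i - y i) ^ 2 =
      a * ∑ i, x i ^ 2 + b * ∑ i, y i ^ 2 := by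
  have hb : b = 1 - a := by linarith
  subst hb
  rw [Finset.mul_sum, Finset.mul_sum, Finset.mul_sum, ← Finset.sum_add_distrib,
    ← Finset.sum_add_distrib]
  apply Finset.sum_congr rfl
  intro i _
  simp only [Pi.add_apply, Pi.smul_apply, smul_eq_mul]
  ring

lemma extremePoints_sphere (V : Set (Fin n → ℝ)) (N : ℝ) (hV : ∀ v ∈ V, ∑ i, v i ^ 2 = N) :
    (convexHull ℝ V).extremePoints ℝ = V := by
  have hle : convexHull ℝ V ⊆ {x | ∑ i, x i ^ 2 ≤ N} := by
    apply convexHull_min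
    · intro v hv; exact (hV v hv).le
    · intro x hx y hy a b ha hb hab
      have h1 := sq_id a b hab x y
      simp only [Set.mem_ofPred_eq] at hx hy ⊢
      have h2 : 0 ≤ a * b * ∑ i, (x i - y i) ^ 2 :=
        mul_nonneg (mul_nonneg ha hb) (Finset.sum_nonneg fun i _ => sq_nonneg _)
      have h3 : a * N + b * N = N := by rw [← add_mul, hab, one_mul]
      nlinarith [mul_le_mul_of_nonneg_left hx ha, mul_le_mul_of_nonneg_left hy hb]
  apply Set.Subset.antisymm extremePoints_convexHull_subset
  intro v hv
  rw [mem_extremePoints]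
  refine ⟨subset_convexHull ℝ V hv, ?_⟩
  rintro x hx y hy ⟨a, b, ha, hb, hab, rfl⟩
  have h1 := sq_id a b hab x y
  have h2 := hV _ hv
  have hx' : ∑ i, x i ^ 2 ≤ N := hle hx
  have hy' : ∑ i, y i ^ 2 ≤ N := hle hy
  have h3 : a * N + b * N = N := by rw [← add_mul, hab, one_mul]
  have h0 : 0 ≤ ∑ i, (x i - y i) ^ 2 := Finset.sum_nonneg fun i _ => sq_nonneg _
  have h4 : a * b * ∑ i, (x i - y i) ^ 2 ≤ 0 := by
    nlinarith [mul_le_mul_of_nonneg_left hx' ha.le, mul_le_mul_of_nonneg_left hy' hb.le]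
  have h5 : ∑ i, (x i - y i) ^ 2 = 0 := by
    have : 0 < a * b := mul_pos ha hb
    nlinarith
  have h6 : x = y := by
    ext i
    have := (Finset.sum_eq_zero_iff_of_nonneg (fun i _ => sq_nonneg _)).1 h5 i (Finset.mem_univ i)
    have := pow_eq_zero_iff (two_ne_zero) |>.1 this
    linarith
  subst h6
  have : a • x + b • x = x := by rw [← add_smul, hab, one_smul]
  rw [this]
  exact ⟨rfl, rfl⟩

lemma extremePoints_bip (w : Perm (Fin n)) :
    (convexHull ℝ (bipV w)).extremePoints ℝ = bipV w := by
  apply extremePoints_sphere _ (∑ i : Fin n, ((i.val : ℝ) + 1) ^ 2)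
  rintro v ⟨u, _, rfl⟩
  exact Equiv.sum_comp u (fun i : Fin n => ((i.val : ℝ) + 1) ^ 2)

lemma extremePoints_cube (m : ℕ) :
    (convexHull ℝ (cubeV m)).extremePoints ℝ = cubeV m := by
  have : convexHull ℝ (cubeV m) = Set.univ.pi fun _ : Fin m => Set.Icc (0 : ℝ) 1 := by
    rw [hull_cubeV]; ext x; simp [Pi.le_def, forall_and]
  rw [this, extremePoints_pi]
  simp [cubeV]

lemma ncard_bipV (w : Perm (Fin n)) : (bipV w).ncard = {u | Ble u w}.ncard := by
  have : bipV w = permPoint n '' {u | Ble u w} := by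
    ext x
    constructor
    · rintro ⟨u, hu, rfl⟩; exact ⟨u, hu, rfl⟩
    · rintro ⟨u, hu, rfl⟩; exact ⟨u, hu, rfl⟩
  rw [this]
  apply Set.ncard_image_of_injective
  intro u v h
  ext i
  have := congrFun h i
  simp only [permPoint] at this
  have h' : ((u i).val : ℝ) = (v i).val := by linarith
  exact_mod_cast h'

lemma ncard_cubeV (m : ℕ) : (cubeV m).ncard = 2 ^ m := by
  unfold cubeV
  rw [← Nat.card_coe_set_eq, Nat.card_congr (Equiv.Set.univPi _), Nat.card_pi]
  simp [Set.ncard_pair]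

def SubF (n : ℕ) (l : List ℕ) : Finset (Perm (Fin n)) := (l.sublists.map (wprod n)).toFinset

lemma mem_SubF (l : List ℕ) (u : Perm (Fin n)) : u ∈ SubF n l ↔ u ∈ SubW n l := by
  simp [SubF, SubW]

lemma ncard_ble (l : List ℕ) (hl : Red n l) : {u | Ble u (wprod n l)}.ncard = (SubF n l).card := by
  rw [← Set.ncard_coe_finset]
  congr 1
  ext u
  simp only [Set.mem_ofPred_eq, Finset.mem_coe]
  rw [mem_SubF, subW_eq l hl]

lemma ncard_3412 : (bipV pattern3412).ncard = 14 := by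
  have h1 : wprod 4 [2, 1, 3, 2] = pattern3412 := by decide
  rw [ncard_bipV, ← h1, ncard_ble _ (by unfold Red; decide)]
  decide

lemma count_of_equiv (w : Perm (Fin n)) (h : CombEquiv (BIP n 1 w)
        (BIP 4 1 pattern3412 ×ˢ
          {x : Fin (permLen n w - 4) → ℝ | ∀ k, x k ∈ Set.Icc (0 : ℝ) 1})) (l : List ℕ)
    (hl : Red n l) (hw : wprod n l = w) : (SubF n l).card = 14 * 2 ^ (l.length - 4) := by
  have hlen : permLen n w = l.length := by rw [permLen_eq, ← hw]; exact hl.symm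
  rw [hlen, BIP_eq, BIP_eq, ← hull_cubeV] at h
  have hQ : (convexHull ℝ (bipV pattern3412) ×ˢ convexHull ℝ (cubeV (l.length - 4))).extremePoints ℝ
      = bipV pattern3412 ×ˢ cubeV (l.length - 4) := by
    rw [extremePoints_prod, extremePoints_bip, extremePoints_cube]
  have := combEquiv_extremePoints h (by rw [extremePoints_bip])
    (by rw [hQ, convexHull_prod])
  rw [extremePoints_bip, hQ, Nat.card_coe_set_eq, Nat.card_coe_set_eq, Set.ncard_prod, ncard_3412,
    ncard_cubeV, ncard_bipV, ← hw, ncard_ble l hl] at this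
  exact this

end extreme


section count
open Equiv

variable {n : ℕ}

lemma simpleT_sq (n k : ℕ) : simpleT n k * simpleT n k = 1 := by
  rcases simpleT_cases n k with ⟨_, h⟩ | ⟨d0, d1, _, _, h⟩ <;> rw [h] <;> simp

lemma simpleT_comm (n j k : ℕ) (h1 : j + 1 ≠ k) (h2 : k + 1 ≠ j) :
    simpleT n j * simpleT n k = simpleT n k * simpleT n j := by
  by_cases hjk : j = k
  · rw [hjk]
  rcases simpleT_cases n k with ⟨_, h⟩ | ⟨d0, d1, a1, a2, h⟩
  · rw [h]; simp
  rcases simpleT_cases n j with ⟨_, h'⟩ | ⟨e0, e1, b1, b2, h'⟩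
  · rw [h']; simp
  rw [h, h']
  refine (Perm.disjoint_swap_swap ?_).commute
  simp [Fin.ext_iff]
  omega

lemma subF_snoc (l : List ℕ) (k : ℕ) : SubF n (l ++ [k]) =
    SubF n l ∪ (SubF n l).image (· * simpleT n k) := by
  ext u
  rw [mem_SubF, mem_subW_snoc]
  simp only [Finset.mem_union, Finset.mem_image, mem_SubF]
  constructor
  · rintro (h | ⟨a, ha, rfl⟩)
    · exact Or.inl h
    · exact Or.inr ⟨a, ha, rfl⟩
  · rintro (h | ⟨a, ha, rfl⟩)
    · exact Or.inl h
    · exact Or.inr ⟨a, ha, rfl⟩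

lemma card_snoc (l : List ℕ) (k : ℕ) : (SubF n (l ++ [k])).card +
    (SubF n l ∩ (SubF n l).image (· * simpleT n k)).card = 2 * (SubF n l).card := by
  rw [subF_snoc, Finset.card_union_add_card_inter,
    Finset.card_image_of_injective _ (mul_left_injective _)]
  ring

lemma mem_inter_image (l : List ℕ) (k : ℕ) (u : Perm (Fin n)) (h1 : u ∈ SubW n l)
    (h2 : u * simpleT n k ∈ SubW n l) :
    u ∈ SubF n l ∩ (SubF n l).image (· * simpleT n k) := by
  rw [Finset.mem_inter, mem_SubF, Finset.mem_image]
  exact ⟨h1, _, (mem_SubF _ _).2 h2, by rw [mul_assoc, simpleT_sq, mul_one]⟩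

lemma subW_mono {l l' : List ℕ} (h : l'.Sublist l) {u : Perm (Fin n)} (hu : u ∈ SubW n l') :
    u ∈ SubW n l := by
  obtain ⟨m, hm, rfl⟩ := hu
  exact ⟨m, hm.trans h, rfl⟩

lemma one_mem_subW (l : List ℕ) : (1 : Perm (Fin n)) ∈ SubW n l :=
  ⟨[], List.nil_sublist l, by simp [wprod]⟩

lemma simple_mem_subW {l : List ℕ} {k : ℕ} (h : k ∈ l) : simpleT n k ∈ SubW n l :=
  ⟨[k], List.singleton_sublist.2 h, by simp [wprod]⟩

lemma card_snoc_lt (l : List ℕ) (k : ℕ) (h : k ∈ l) :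
    (SubF n (l ++ [k])).card < 2 * (SubF n l).card := by
  have h1 := card_snoc (n := n) l k
  have h2 : 0 < (SubF n l ∩ (SubF n l).image (· * simpleT n k)).card :=
    Finset.card_pos.2 ⟨1, mem_inter_image l k 1 (one_mem_subW l)
      (by rw [one_mul]; exact simple_mem_subW h)⟩
  omega

lemma nk_new (k : ℕ) (hk : 1 ≤ k ∧ k < n) (u : Perm (Fin n)) (hu : nk k u = 0) :
    nk k (u * simpleT n k) = 1 := by
  rcases simpleT_cases n k with ⟨h, _⟩ | ⟨d0, d1, a1, a2, h⟩
  · exact absurd hk h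
  rw [h]
  have h1 := nk_adj' u d0 d1 a1
  rw [← a2] at h1
  have h2 := nk_zero_iff hu d0
  have h3 := nk_zero_iff hu d1
  rw [if_neg (by omega), if_pos (by omega)] at h1
  omega

lemma nk_subW_zero {l : List ℕ} {k : ℕ} (hk : k ∉ l) {u : Perm (Fin n)} (hu : u ∈ SubW n l) :
    nk k u = 0 := by
  obtain ⟨m, hm, rfl⟩ := hu
  have h1 := nk_wprod (n := n) k m
  have h2 := hm.count_le k
  rw [List.count_eq_zero_of_not_mem hk] at h2
  omega

lemma card_nodup (l : List ℕ) (hv : ∀ k ∈ l, 1 ≤ k ∧ k < n) (hn : l.Nodup) :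
    (SubF n l).card = 2 ^ l.length := by
  induction l using List.reverseRecOn with
  | nil => simp [SubF]
  | append_singleton l k ih =>
    have hk : k ∉ l := by
      intro h
      rw [List.nodup_append] at hn
      exact hn.2.2 k h k (by simp) rfl
    have ih' := ih (fun x hx => hv x (by simp [hx])) (hn.sublist (List.sublist_append_left _ _))
    have h1 := card_snoc (n := n) l k
    have h2 : SubF n l ∩ (SubF n l).image (· * simpleT n k) = ∅ := by
      rw [Finset.eq_empty_iff_forall_notMem]
      intro u hu
      rw [Finset.mem_inter, mem_SubF, Finset.mem_image] at hu
      obtain ⟨hu1, a, ha, rfl⟩ := hu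
      rw [mem_SubF] at ha
      have h3 := nk_new k (hv k (by simp)) a (nk_subW_zero hk ha)
      have h4 := nk_subW_zero hk hu1
      omega
    rw [h2] at h1
    simp only [Finset.card_empty, add_zero] at h1
    rw [h1, ih', List.length_append, List.length_singleton, pow_succ]
    ring

lemma wprod_comm (k : ℕ) (l : List ℕ) (h : ∀ a ∈ l, a + 1 ≠ k ∧ k + 1 ≠ a) :
    wprod n l * simpleT n k = simpleT n k * wprod n l := by
  induction l with
  | nil => simp [wprod]
  | cons a l ih =>
    have ih' := ih (fun x hx => h x (by simp [hx]))
    have ha := h a (by simp)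
    have hc := simpleT_comm n a k ha.1 ha.2
    simp only [wprod, List.map_cons, List.prod_cons] at ih' ⊢
    rw [mul_assoc, ih', ← mul_assoc, hc, mul_assoc]

lemma overlap (x y : List ℕ) (k : ℕ) (hv : ∀ a ∈ x ++ [k] ++ y, 1 ≤ a ∧ a < n)
    (hn : (x ++ [k] ++ y).Nodup) (c : ℕ)
    (hc : (y.filter (fun a => decide (a + 1 = k ∨ k + 1 = a))).length ≤ c) :
    2 ^ (x ++ [k] ++ y).length ≤
      2 ^ c * (SubF n (x ++ [k] ++ y) ∩ (SubF n (x ++ [k] ++ y)).image (· * simpleT n k)).card := by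
  set y' := y.filter (fun a => !decide (a + 1 = k ∨ k + 1 = a)) with hy'
  have hsub : (x ++ [k] ++ y').Sublist (x ++ [k] ++ y) :=
    (List.Sublist.refl _).append List.filter_sublist
  have h1 := card_nodup (n := n) (x ++ [k] ++ y') (fun a ha => hv a (hsub.subset ha))
    (hn.sublist hsub)
  have h2 : SubF n (x ++ [k] ++ y') ⊆
      SubF n (x ++ [k] ++ y) ∩ (SubF n (x ++ [k] ++ y)).image (· * simpleT n k) := by
    intro u hu
    rw [mem_SubF] at hu
    refine mem_inter_image _ _ _ (subW_mono hsub hu) (subW_mono hsub ?_)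
    obtain ⟨a, ha, b, ⟨m, hm, rfl⟩, rfl⟩ := (subW_append _ _ _).1 hu
    have hcm := wprod_comm (n := n) k m (by
      intro t ht
      have := hm.subset ht
      rw [hy', List.mem_filter] at this
      simp at this
      tauto)
    rw [mul_assoc, hcm, ← mul_assoc, subW_append]
    refine ⟨a * simpleT n k, ?_, _, ⟨m, hm, rfl⟩, rfl⟩
    rw [mem_subW_snoc] at ha ⊢
    rcases ha with ha | ⟨a', ha', rfl⟩
    · exact Or.inr ⟨a, ha, rfl⟩
    · left; rw [mul_assoc, simpleT_sq, mul_one]; exact ha'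
  have h3 := Finset.card_le_card h2
  rw [h1] at h3
  refine le_trans ?_ (Nat.mul_le_mul_left _ h3)
  rw [← pow_add]
  apply Nat.pow_le_pow_right (by norm_num)
  have h4 := List.length_eq_length_filter_add (l := y) (fun a => decide (a + 1 = k ∨ k + 1 = a))
  simp only [List.length_append]
  rw [hy']
  omega

lemma pair_sublist {a b : ℕ} (hab : a ≠ b) {y : List ℕ} (ha : a ∈ y) (hb : b ∈ y) :
    [a, b].Sublist y ∨ [b, a].Sublist y := by
  obtain ⟨s, t, rfl⟩ := List.append_of_mem ha
  simp only [List.mem_append, List.mem_cons] at hb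
  rcases hb with h | h | h
  · right
    exact (List.singleton_sublist.2 h).append (List.singleton_sublist.2 (by simp))
  · exact absurd h.symm hab
  · left
    exact List.sublist_append_of_sublist_right ((List.singleton_sublist.2 h).cons_cons a)

def CaseC (l : List ℕ) : Prop := ∃ j, l.count j = 2 ∧ (∀ k ≠ j, l.count k ≤ 1) ∧
  1 ≤ j ∧
  ([j, j - 1, j + 1, j].Sublist l ∨ [j, j + 1, j - 1, j].Sublist l)

lemma trichotomy (l : List ℕ) (hv : ∀ k ∈ l, 1 ≤ k ∧ k < n) :
    l.Nodup ∨ 8 * (SubF n l).card < 7 * 2 ^ l.length ∨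
      (8 * (SubF n l).card ≤ 7 * 2 ^ l.length ∧ CaseC l) := by
  induction l using List.reverseRecOn with
  | nil => left; simp
  | append_singleton l k ih =>
    have hvl : ∀ k ∈ l, 1 ≤ k ∧ k < n := fun x hx => hv x (by simp [hx])
    have hsn := card_snoc (n := n) l k
    have hp : 2 ^ (l ++ [k]).length = 2 * 2 ^ l.length := by
      rw [List.length_append, List.length_singleton, pow_succ]; ring
    rcases ih hvl with h | h | ⟨h, j, hj1, hj2, hj4, hj5⟩
    · by_cases hk : k ∈ l
      · right
        have hcard := card_nodup l hvl h
        obtain ⟨x, y, hxy⟩ := List.append_of_mem hk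
        rw [List.append_cons] at hxy
        subst hxy
        set fl := y.filter (fun a => decide (a + 1 = k ∨ k + 1 = a)) with hfl
        have hyn : y.Nodup := h.sublist (List.sublist_append_right _ _)
        have hfn : fl.Nodup := hyn.filter _
        have hk1 := (hv k (by simp)).1
        by_cases hboth : k - 1 ∈ y ∧ k + 1 ∈ y
        · right
          have hf2 : fl.length ≤ 2 := by
            have : fl ⊆ [k - 1, k + 1] := by
              intro a ha
              rw [hfl, List.mem_filter] at ha
              simp at ha ⊢
              omega
            exact (hfn.subperm this).length_le
          have ho := overlap x y k hvl h 2 hf2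
          refine ⟨by omega, k, ?_, ?_, hk1, ?_⟩
          · rw [List.count_append, List.count_eq_one_of_mem h hk]; simp
          · intro t ht
            rw [List.count_append, List.count_singleton]
            have := List.nodup_iff_count_le_one.1 h t
            have ht' : (k == t) = false := by simpa using Ne.symm ht
            rw [ht']
            simpa using this
          · have hx : ∀ p q : ℕ, [p, q].Sublist y → [k, p, q, k].Sublist (x ++ [k] ++ y ++ [k]) := by
              intro p q hpq
              have h1 : [k].Sublist (x ++ [k]) := List.sublist_append_right _ _
              have := (h1.append hpq).append (List.Sublist.refl [k])
              simpa using this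
            rcases pair_sublist (by omega) hboth.1 hboth.2 with hs | hs
            · exact Or.inl (hx _ _ hs)
            · exact Or.inr (hx _ _ hs)
        · left
          have hf1 : fl.length ≤ 1 := by
            have : ∃ c, fl ⊆ [c] := by
              by_cases h1 : k - 1 ∈ y
              · refine ⟨k - 1, ?_⟩
                intro a ha
                rw [hfl, List.mem_filter] at ha
                simp at ha ⊢
                rcases ha.2 with h2 | h2
                · omega
                · exact absurd ⟨h1, h2 ▸ ha.1⟩ hboth
              · refine ⟨k + 1, ?_⟩
                intro a ha
                rw [hfl, List.mem_filter] at ha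
                simp at ha ⊢
                rcases ha.2 with h2 | h2
                · have : a = k - 1 := by omega
                  exact absurd (this ▸ ha.1) h1
                · omega
            obtain ⟨c, hc⟩ := this
            exact (hfn.subperm hc).length_le
          have ho := overlap x y k hvl h 1 hf1
          have hpos : 0 < 2 ^ (x ++ [k] ++ y).length := by positivity
          omega
      · left
        rw [List.nodup_append]
        refine ⟨h, by simp, ?_⟩
        intro a ha b hb
        simp at hb
        subst hb
        rintro rfl
        exact hk ha
    · right; left
      omega
    · right
      by_cases hk : k ∈ l
      · left
        have := card_snoc_lt (n := n) l k hk
        omega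
      · right
        have hjk : k ≠ j := by
          rintro rfl
          rw [List.count_eq_zero_of_not_mem hk] at hj1
          omega
        refine ⟨by omega, j, ?_, ?_, hj4, ?_⟩
        · rw [List.count_append, hj1, List.count_eq_zero_of_not_mem (by simpa using hjk.symm)]
        · intro t ht
          rw [List.count_append, List.count_singleton]
          by_cases htk : k = t
          · subst htk
            rw [List.count_eq_zero_of_not_mem hk]; simp
          · have ht' : (k == t) = false := by simpa using htk
            rw [ht']
            simpa using hj2 t ht
        · exact hj5.imp (fun h => h.trans (List.sublist_append_left _ _))
            (fun h => h.trans (List.sublist_append_left _ _))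

lemma nk_four (j : ℕ) (h1 : 2 ≤ j) (h2 : j + 1 < n) :
    nk j (wprod n [j, j - 1, j + 1, j]) = 2 := by
  let d : Fin 4 → Fin n := fun t => ⟨j - 2 + t.val, by have := t.isLt; omega⟩
  have v0 : (d 0).val = j - 2 := rfl
  have v1 : (d 1).val = j - 1 := by simp [d]; omega
  have v2 : (d 2).val = j := by simp [d]; omega
  have v3 : (d 3).val = j + 1 := by simp [d]; omega
  clear_value d
  have s2 : simpleT n j = swap (d 1) (d 2) := by rw [← simpleT_swap _ _ (by omega), v2]
  have s1 : simpleT n (j - 1) = swap (d 0) (d 1) := by rw [← simpleT_swap _ _ (by omega), v1]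
  have s3 : simpleT n (j + 1) = swap (d 2) (d 3) := by rw [← simpleT_swap _ _ (by omega), v3]
  have hw : wprod n [j, j - 1, j + 1, j] =
      swap (d 1) (d 2) * swap (d 0) (d 1) * swap (d 2) (d 3) * swap (d 1) (d 2) := by
    simp [wprod, s1, s2, s3, mul_assoc]
  have n01 : d 0 ≠ d 1 := by rw [Ne, Fin.ext_iff]; omega
  have n02 : d 0 ≠ d 2 := by rw [Ne, Fin.ext_iff]; omega
  have n03 : d 0 ≠ d 3 := by rw [Ne, Fin.ext_iff]; omega
  have n12 : d 1 ≠ d 2 := by rw [Ne, Fin.ext_iff]; omega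
  have n13 : d 1 ≠ d 3 := by rw [Ne, Fin.ext_iff]; omega
  have n23 : d 2 ≠ d 3 := by rw [Ne, Fin.ext_iff]; omega
  have k1 : nk j (swap (d 1) (d 2)) = 1 := by
    have := nk_new (n := n) j (by omega) 1 (nk_one j)
    rwa [one_mul, s2] at this
  have k3 : nk j (swap (d 1) (d 2) * swap (d 0) (d 1) * swap (d 2) (d 3)) = 1 := by
    rw [nk_adj j _ (d 2) (d 3) (by omega) (by omega), nk_adj j _ (d 0) (d 1) (by omega) (by omega), k1]
  have h4 := nk_adj' (swap (d 1) (d 2) * swap (d 0) (d 1) * swap (d 2) (d 3)) (d 1) (d 2) (by omega)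
  have e1 : (swap (d 1) (d 2) * swap (d 0) (d 1) * swap (d 2) (d 3)) (d 1) = d 0 := by
    simp only [Perm.mul_apply]
    rw [swap_apply_of_ne_of_ne n12 n13, swap_apply_right, swap_apply_of_ne_of_ne n01 n02]
  have e2 : (swap (d 1) (d 2) * swap (d 0) (d 1) * swap (d 2) (d 3)) (d 2) = d 3 := by
    simp only [Perm.mul_apply]
    rw [swap_apply_left, swap_apply_of_ne_of_ne n03.symm n13.symm,
      swap_apply_of_ne_of_ne n13.symm n23.symm]
  rw [e1, e2, v0, v2, v3, k3, if_neg (by omega), if_pos (by omega)] at h4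
  rw [hw]
  omega

lemma cl_of_caseC (l : List ℕ) (hl : Red n l) (hc : CaseC l) : ∃ i, Cl (wprod n l) i := by
  obtain ⟨j, h1, h2, _, h5⟩ := hc
  have hv := hl.valid
  have hjm : j - 1 ∈ l ∧ j + 1 ∈ l := by
    rcases h5 with h | h
    · exact ⟨h.subset (by simp), h.subset (by simp)⟩
    · exact ⟨h.subset (by simp), h.subset (by simp)⟩
  have b1 := hv _ hjm.1
  have b2 := hv _ hjm.2
  have hmem : wprod n [j, j - 1, j + 1, j] ∈ SubW n l := by
    rcases h5 with h | h
    · exact ⟨_, h, rfl⟩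
    · refine ⟨_, h, ?_⟩
      have := simpleT_comm n (j + 1) (j - 1) (by omega) (by omega)
      simp only [wprod, List.map_cons, List.map_nil, List.prod_cons, List.prod_nil, mul_one]
      rw [← mul_assoc (simpleT n (j + 1)), this, mul_assoc (simpleT n (j - 1))]
  have hj2 : 2 ≤ nk j (wprod n l) := by
    rw [← nk_four (n := n) j (by omega) (by omega)]
    exact nk_mono j ((subW_eq l hl _).1 hmem)
  have hk1 : ∀ k ∈ l, 1 ≤ nk k (wprod n l) := by
    intro k hk
    have h := nk_new (n := n) k (hv k hk) 1 (nk_one k)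
    rw [one_mul] at h
    rw [← h]
    exact nk_mono k ((subW_eq l hl _).1 (simple_mem_subW hk))
  have hle : ∀ k ∈ l, l.count k ≤ nk k (wprod n l) := by
    intro k hk
    by_cases hkj : k = j
    · subst hkj; omega
    · exact (h2 k hkj).trans (hk1 k hk)
  have hD : invN (wprod n l) = Dd (wprod n l) := by
    apply le_antisymm _ (Dd_le _)
    rw [← show l.length = invN (wprod n l) from hl, ← List.sum_toFinset_count_eq_length]
    unfold Dd
    calc ∑ k ∈ l.toFinset, l.count k ≤ ∑ k ∈ l.toFinset, nk k (wprod n l) :=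
          Finset.sum_le_sum fun k hk => hle k (by simpa using hk)
      _ ≤ _ := Finset.sum_le_sum_of_subset fun k hk => by
          rw [List.mem_toFinset] at hk
          exact Finset.mem_range.2 (hv k hk).2
  refine ⟨j, av321_of_Dd _ _ rfl hD, le_antisymm ((nk_wprod j l).trans h1.le) hj2, fun k hk => ?_⟩
  exact (nk_wprod k l).trans (h2 k hk)

lemma card_le_pow (l : List ℕ) : (SubF n l).card ≤ 2 ^ l.length := by
  unfold SubF
  refine (List.toFinset_card_le _).trans ?_
  simp

lemma forward (w : Equiv.Perm (Fin n)) (h : CombEquiv (BIP n 1 w)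
        (BIP 4 1 pattern3412 ×ˢ
          {x : Fin (permLen n w - 4) → ℝ | ∀ k, x k ∈ Set.Icc (0 : ℝ) 1})) :
    ContainsPatternOnce w pattern3412 ∧ AvoidsPattern w pattern321 := by
  obtain ⟨l, hl, hw⟩ := exists_red w
  have hc := count_of_equiv w h l hl hw
  have hle := card_le_pow (n := n) l
  have h4 : 4 ≤ l.length := by
    by_contra hcon
    have h3 : l.length ≤ 3 := by omega
    rw [show l.length - 4 = 0 by omega] at hc
    have : 2 ^ l.length ≤ 2 ^ 3 := Nat.pow_le_pow_right (by norm_num) h3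
    omega
  have hp : 2 ^ l.length = 16 * 2 ^ (l.length - 4) := by
    rw [show (16 : ℕ) = 2 ^ 4 by norm_num, ← pow_add]
    congr 1; omega
  have hpos : 0 < 2 ^ (l.length - 4) := by positivity
  rw [pattern_iff]
  rcases trichotomy (n := n) l hl.valid with h | h | ⟨_, h⟩
  · have := card_nodup l hl.valid h
    omega
  · omega
  · rw [← hw]; exact cl_of_caseC l hl h

end count

/-- `Q_{e,w}` is combinatorially equivalent to the product of
`Q_{e,3412} ⊂ ℝ⁴` and the cube `I^{ℓ(w) - 4}` iff `w` contains 3412 exactly once and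
avoids 321. -/
theorem stmt18 (n : ℕ) (w : Equiv.Perm (Fin n)) :
    CombEquiv (BIP n 1 w)
        (BIP 4 1 pattern3412 ×ˢ
          {x : Fin (permLen n w - 4) → ℝ | ∀ k, x k ∈ Set.Icc (0 : ℝ) 1}) ↔
      ContainsPatternOnce w pattern3412 ∧ AvoidsPattern w pattern321 := by
  exact ⟨forward w, backward n w⟩
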